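/- arXiv:1409.6692 — 9 statements merged into one kernel-verified Lean document; each statement's English description precedes it below -/
import Mathlib

section
/- Let c be a real constant, let u_0 : ℝ → ℝ and g : ℝ → ℝ with g continuous, and define g_t(x) := max_{τ ∈ [0,t]} g(x − cτ) and u(t,x) := max(u_0(x − ct), g_t(x)) for t ≥ 0. Then u satisfies the dynamic programming principle: for every t ≥ 0, every Δt ≥ 0 and every x ∈ ℝ, u(t + Δt, x) = max( u(t, x − cΔt), max_{τ ∈ [0,Δt]} g(x − cτ) ). -/
/-- `gmax g c t x = max_{τ ∈ [0,t]} g (x - c τ)` (sup of a continuous function on a compact). -/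
noncomputable def gmax (g : ℝ → ℝ) (c t x : ℝ) : ℝ :=
  sSup ((fun τ => g (x - c * τ)) '' Set.Icc 0 t)

theorem gmax_add {g : ℝ → ℝ} (hg : Continuous g) (c : ℝ) {t dt : ℝ} (ht : 0 ≤ t)
    (hdt : 0 ≤ dt) (x : ℝ) :
    gmax g c (t + dt) x = max (gmax g c t (x - c * dt)) (gmax g c dt x) := by
  have bdd : ∀ a y, BddAbove ((fun τ => g (y - c * τ)) '' Set.Icc 0 a) := fun a y =>
    (isCompact_Icc.image (by fun_prop)).bddAbove
  have nonempty : ∀ a y, 0 ≤ a → ((fun τ => g (y - c * τ)) '' Set.Icc 0 a).Nonempty :=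
    fun a y ha => (Set.nonempty_Icc.2 ha).image _
  unfold gmax
  refine Eq.trans ?_ (csSup_union (bdd _ _) (nonempty _ _ ht) (bdd _ _) (nonempty _ _ hdt))
  congr 1
  ext z
  constructor
  · rintro ⟨τ, ⟨h0, h1⟩, rfl⟩
    rcases le_total τ dt with h | h
    · exact Or.inr ⟨τ, ⟨h0, h⟩, rfl⟩
    · refine Or.inl ⟨τ - dt, ⟨by linarith, by linarith⟩, ?_⟩
      dsimp only
      congr 1
      ring
  · rintro (⟨τ, ⟨h0, h1⟩, rfl⟩ | ⟨τ, ⟨h0, h1⟩, rfl⟩)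
    · refine ⟨τ + dt, ⟨by linarith, by linarith⟩, ?_⟩
      dsimp only
      congr 1
      ring
    · exact ⟨τ, ⟨h0, by linarith⟩, rfl⟩

/-- Dynamic programming principle for
`u(t,x) = max(u₀(x - c t), max_{τ ∈ [0,t]} g(x - c τ))`. -/
theorem stmt0 (c : ℝ) (u0 g : ℝ → ℝ) (hg : Continuous g)
    (u : ℝ → ℝ → ℝ)
    (hu : ∀ t x, u t x = max (u0 (x - c * t)) (gmax g c t x)) :
    ∀ t, 0 ≤ t → ∀ dt, 0 ≤ dt → ∀ x : ℝ,
      u (t + dt) x = max (u t (x - c * dt)) (gmax g c dt x) := by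
  intro t ht dt hdt x
  have hx : x - c * (t + dt) = x - c * dt - c * t := by ring
  rw [hu, hu, gmax_add hg c ht hdt, hx, max_assoc]
end

section
/- Let c be a real constant, let u_0 : ℝ → ℝ be Lipschitz continuous with constant at most L_{u_0}, and let g : ℝ → ℝ be continuous and Lipschitz continuous with constant at most L_g. Define g_t(x) := max_{τ ∈ [0,t]} g(x − cτ) and u(t,x) := max(u_0(x − ct), g_t(x)). Then u is Lipschitz continuous in time: for all s, t ≥ 0 and all x ∈ ℝ, |u(t,x) − u(s,x)| ≤ |c| · max(L_{u_0}, L_g) · |t − s|. -/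
lemma gmax_le_gmax_add {c L : ℝ} {g : ℝ → ℝ} (hg : Continuous g)
    (hL : ∀ x y, |g x - g y| ≤ L * |x - y|) {s t : ℝ} (hs : 0 ≤ s) (ht : 0 ≤ t) (x : ℝ) :
    gmax g c t x ≤ gmax g c s x + |c| * L * |t - s| := by
  have hL0 : 0 ≤ L := by simpa using (abs_nonneg _).trans (hL 1 0)
  have hbdd : BddAbove ((fun τ => g (x - c * τ)) '' Set.Icc 0 s) :=
    (isCompact_Icc.image (by fun_prop)).bddAbove
  refine csSup_le ((Set.nonempty_Icc.2 ht).image _) ?_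
  rintro _ ⟨τ, ⟨hτ0, hτt⟩, rfl⟩
  have hle : g (x - c * min τ s) ≤ gmax g c s x :=
    le_csSup hbdd ⟨min τ s, ⟨le_min hτ0 hs, min_le_right _ _⟩, rfl⟩
  have hdist : |min τ s - τ| ≤ |t - s| := by
    rcases le_total τ s with h | h
    · simp [min_eq_left h]
    · rw [min_eq_right h, abs_sub_comm, abs_of_nonneg (sub_nonneg.2 h)]
      exact (sub_le_sub_right hτt s).trans (le_abs_self _)
  have hlip := (le_abs_self _).trans (hL (x - c * τ) (x - c * min τ s))
  rw [show x - c * τ - (x - c * min τ s) = c * (min τ s - τ) by ring, abs_mul] at hlip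
  have hmul : L * (|c| * |min τ s - τ|) ≤ L * (|c| * |t - s|) := by gcongr
  dsimp only
  linarith

lemma abs_gmax_sub_gmax_le {c L : ℝ} {g : ℝ → ℝ} (hg : Continuous g)
    (hL : ∀ x y, |g x - g y| ≤ L * |x - y|) {s t : ℝ} (hs : 0 ≤ s) (ht : 0 ≤ t) (x : ℝ) :
    |gmax g c t x - gmax g c s x| ≤ |c| * L * |t - s| := by
  have h₁ := gmax_le_gmax_add (c := c) hg hL hs ht x
  have h₂ := gmax_le_gmax_add (c := c) hg hL ht hs x
  rw [abs_sub_comm s t] at h₂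
  rw [abs_sub_le_iff]
  constructor <;> linarith

/-- Time Lipschitz regularity of the obstacle solution
`u(t,x) = max(u₀(x - ct), max_{τ ∈ [0,t]} g(x - cτ))`:
for `s, t ≥ 0` and all `x`, `|u(t,x) - u(s,x)| ≤ |c| · max(Lu0, Lg) · |t - s|`. -/
theorem stmt3 (c Lu0 Lg : ℝ) (u0 g : ℝ → ℝ)
    (hu0 : ∀ x y, |u0 x - u0 y| ≤ Lu0 * |x - y|)
    (hg : Continuous g)
    (hglip : ∀ x y, |g x - g y| ≤ Lg * |x - y|)
    (u : ℝ → ℝ → ℝ)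
    (hu : ∀ t x, u t x = max (u0 (x - c * t)) (gmax g c t x)) :
    ∀ s, 0 ≤ s → ∀ t, 0 ≤ t → ∀ x : ℝ,
      |u t x - u s x| ≤ |c| * max Lu0 Lg * |t - s| := by
  intro s hs t ht x
  rw [hu, hu]
  refine (abs_max_sub_max_le_max _ _ _ _).trans (max_le ?_ ?_)
  · calc |u0 (x - c * t) - u0 (x - c * s)|
        ≤ Lu0 * |x - c * t - (x - c * s)| := hu0 _ _
      _ = |c| * Lu0 * |t - s| := by
        rw [show x - c * t - (x - c * s) = c * (s - t) by ring, abs_mul, abs_sub_comm s t]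
        ring
      _ ≤ |c| * max Lu0 Lg * |t - s| := by
        gcongr
        exact le_max_left _ _
  · refine (abs_gmax_sub_gmax_le hg hglip hs ht x).trans ?_
    gcongr
    exact le_max_right _ _
end

section
/- Let c > 0, Δt > 0, and let g : ℝ → ℝ be continuous and 1-periodic, and assume the set of local maximum points of g in [0,1) has at most q elements, where q ≥ 1 is an integer. Define g_{Δt}(x) := max_{τ ∈ [0,Δt]} g(x − cτ) and g̃(x) := max( g(x), g(x − cΔt) ). Then the Lebesgue measure of the set { x ∈ (0,1) : g_{Δt}(x) ≠ g̃(x) } is at most q·c·Δt. -/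
open Set in
/-- Where `gmax g c t` differs from the maximum of the two endpoint values, some interior point
is a local maximum point. -/
theorem exists_isLocalMax_of_gmax_ne {g : ℝ → ℝ} (hg : Continuous g) {c t x : ℝ} (hc : 0 < c)
    (ht : 0 < t) (hx : gmax g c t x ≠ max (g x) (g (x - c * t))) :
    ∃ y, IsLocalMax g y ∧ x ∈ Ioo y (y + c * t) := by
  obtain ⟨τ, hτ, hmax⟩ := isCompact_Icc.exists_isMaxOn (nonempty_Icc.2 ht.le)
    (show Continuous fun τ => g (x - c * τ) by fun_prop).continuousOn
  have hsup : gmax g c t x = g (x - c * τ) :=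
    IsGreatest.csSup_eq ⟨mem_image_of_mem _ hτ, forall_mem_image.2 fun s hs => hmax hs⟩
  have h0 : g x ≤ g (x - c * τ) := by simpa using hmax (left_mem_Icc.2 ht.le)
  have h1 : g (x - c * t) ≤ g (x - c * τ) := hmax (right_mem_Icc.2 ht.le)
  have hτ0 : 0 < τ := hτ.1.lt_of_ne' fun h => hx <| by
    rw [hsup]; subst h; simp only [mul_zero, sub_zero] at h1 ⊢; exact (max_eq_left h1).symm
  have hτt : τ < t := hτ.2.lt_of_ne fun h => hx <| by
    rw [hsup]; subst h; exact (max_eq_right h0).symm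
  have hpos : 0 < c * τ := mul_pos hc hτ0
  have hlt : c * τ < c * t := mul_lt_mul_of_pos_left hτt hc
  refine ⟨x - c * τ, ?_, by linarith, by linarith⟩
  filter_upwards [Icc_mem_nhds (show x - c * t < x - c * τ by linarith)
    (show x - c * τ < x by linarith)] with z hz
  have hs : (x - z) / c ∈ Icc 0 t :=
    ⟨div_nonneg (by linarith [hz.2]) hc.le, (div_le_iff₀ hc).2 (by linarith [hz.1])⟩
  have hle : g (x - c * ((x - z) / c)) ≤ g (x - c * τ) := hmax hs
  rwa [mul_div_cancel₀ _ hc.ne', sub_sub_cancel] at hle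

/-- The fractional part of a local maximum point is a local maximum point. -/
theorem Function.Periodic.isLocalMax_fract {g : ℝ → ℝ} (hper : Function.Periodic g 1) {y : ℝ}
    (hy : IsLocalMax g y) : IsLocalMax g (Int.fract y) := by
  have hshift : ∀ z, g (z + ⌊y⌋) = g z := fun z => by simpa using hper.int_mul ⌊y⌋ z
  have hcont : Filter.Tendsto (fun z : ℝ => z + ⌊y⌋) (nhds (Int.fract y)) (nhds y) := by
    have h : Continuous fun z : ℝ => z + ⌊y⌋ := by fun_prop
    simpa [Int.fract_add_floor] using h.tendsto (Int.fract y)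
  filter_upwards [hcont.eventually hy] with z hz
  rw [hshift] at hz
  rwa [← hshift (Int.fract y), Int.fract_add_floor]

open Set MeasureTheory in
/-- The part of the unit interval covered by the integer translates of a set has measure at most
that of the set. -/
theorem volume_unitInterval_inter_translates_le {s : Set ℝ} (hs : MeasurableSet s) :
    volume (⋃ k : ℤ, (fun x : ℝ => x + k) ⁻¹' (Ioo (k : ℝ) (k + 1) ∩ s)) ≤ volume s := by
  have hdisj : Pairwise (Function.onFun Disjoint fun k : ℤ => Ioo (k : ℝ) (k + 1) ∩ s) :=
    fun i j hij => ((pairwise_disjoint_Ioo_intCast ℝ) hij).mono inter_subset_left inter_subset_left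
  calc volume (⋃ k : ℤ, (fun x : ℝ => x + k) ⁻¹' (Ioo (k : ℝ) (k + 1) ∩ s))
      ≤ ∑' k : ℤ, volume ((fun x : ℝ => x + k) ⁻¹' (Ioo (k : ℝ) (k + 1) ∩ s)) :=
        measure_iUnion_le _
    _ = ∑' k : ℤ, volume (Ioo (k : ℝ) (k + 1) ∩ s) := by simp only [measure_preimage_add_right]
    _ = volume (⋃ k : ℤ, Ioo (k : ℝ) (k + 1) ∩ s) :=
        (measure_iUnion hdisj fun k => measurableSet_Ioo.inter hs).symm
    _ ≤ volume s := measure_mono (iUnion_subset fun k => inter_subset_right)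

/-- If the continuous `1`-periodic function `g` has at most `q` local maximum points in
`[0,1)`, then the set where `g_{Δt}(x) := max_{τ∈[0,Δt]} g(x-cτ)` differs from
`max(g(x), g(x-cΔt))` has Lebesgue measure at most `q·c·Δt`. -/
theorem stmt5 (c dt : ℝ) (hc : 0 < c) (hdt : 0 < dt) (q : ℕ) (hq : 1 ≤ q)
    (g : ℝ → ℝ) (hg : Continuous g) (hper : Function.Periodic g 1)
    (hcard : {y ∈ Set.Ico (0:ℝ) 1 | IsLocalMax g y}.encard ≤ (q : ℕ∞)) :
    MeasureTheory.volume
        {x ∈ Set.Ioo (0:ℝ) 1 | gmax g c dt x ≠ max (g x) (g (x - c * dt))}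
      ≤ ENNReal.ofReal ((q : ℝ) * c * dt) := by
  have hfin := Set.finite_of_encard_le_coe hcard
  have hle : hfin.toFinset.card ≤ q := by
    rw [hfin.encard_eq_coe_toFinset_card] at hcard
    exact_mod_cast hcard
  have hcover : {x ∈ Set.Ioo (0:ℝ) 1 | gmax g c dt x ≠ max (g x) (g (x - c * dt))} ⊆
      ⋃ y ∈ hfin.toFinset, ⋃ k : ℤ, (fun x : ℝ => x + k) ⁻¹'
        (Set.Ioo (k : ℝ) (k + 1) ∩ Set.Ioo y (y + c * dt)) := by
    rintro x ⟨hx, hne⟩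
    obtain ⟨y, hy, hyx⟩ := exists_isLocalMax_of_gmax_ne hg hc hdt hne
    simp only [Set.mem_iUnion]
    refine ⟨Int.fract y, hfin.mem_toFinset.2
      ⟨⟨Int.fract_nonneg y, Int.fract_lt_one y⟩, hper.isLocalMax_fract hy⟩, -⌊y⌋, ?_⟩
    have hfl := Int.fract_add_floor y
    simp only [Set.mem_preimage, Set.mem_inter_iff, Set.mem_Ioo, Int.cast_neg] at hx hyx ⊢
    refine ⟨⟨?_, ?_⟩, ?_, ?_⟩ <;> linarith [hx.1, hx.2, hyx.1, hyx.2]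
  calc _ ≤ _ := MeasureTheory.measure_mono hcover
    _ ≤ ∑ y ∈ hfin.toFinset, _ := MeasureTheory.measure_biUnion_finset_le _ _
    _ ≤ ∑ y ∈ hfin.toFinset, ENNReal.ofReal (c * dt) := Finset.sum_le_sum fun y _ =>
        (volume_unitInterval_inter_translates_le measurableSet_Ioo).trans_eq
          (by rw [Real.volume_Ioo, add_sub_cancel_left])
    _ = (hfin.toFinset.card : ENNReal) * ENNReal.ofReal (c * dt) := by
        rw [Finset.sum_const, nsmul_eq_mul]
    _ ≤ (q : ENNReal) * ENNReal.ofReal (c * dt) := by gcongr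
    _ = ENNReal.ofReal ((q : ℝ) * c * dt) := by
        rw [mul_assoc, ENNReal.ofReal_mul (Nat.cast_nonneg q), ENNReal.ofReal_natCast]
end

section
/- Let c > 0, let q ≥ 1 be an integer, and let g : ℝ → ℝ be continuous, 1-periodic, and belong to Δ²_q, i.e. the set of local maximum points of g in [0,1) has at most q elements and g is twice differentiable at each local maximum point. For Δt > 0 define g_{Δt}(x) := max_{τ ∈ [0,Δt]} g(x − cτ) and g̃(x) := max( g(x), g(x − cΔt) ). Then there exist constants C ≥ 0 and δ > 0 such that for every Δt ∈ (0, δ], ‖g̃ − g_{Δt}‖_{L²(0,1)} ≤ C √q · Δt^{5/2}. -/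
/-- The `L²` norm on the interval `(0,1)`. -/
noncomputable def L2norm01 (f : ℝ → ℝ) : ℝ :=
  Real.sqrt (∫ x in Set.Ioo (0:ℝ) 1, (f x) ^ 2)

/-- A function that is twice differentiable at a local maximum deviates from its maximal value at
most quadratically nearby. -/
lemma IsLocalMax.exists_abs_sub_le_mul_sq {g : ℝ → ℝ} {y : ℝ} (hy : IsLocalMax g y)
    (hd : ∀ᶠ z in nhds y, DifferentiableAt ℝ g z) (hd2 : DifferentiableAt ℝ (deriv g) y) :
    ∃ K, 0 ≤ K ∧ ∀ᶠ z in nhds y, |g z - g y| ≤ K * (z - y) ^ 2 := by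
  obtain ⟨K, hK, hbound⟩ := hd2.isBigO_sub.exists_nonneg
  refine ⟨K, hK, ?_⟩
  obtain ⟨r, hr, hball⟩ := Metric.eventually_nhds_iff_ball.1 (hd.and hbound.bound)
  filter_upwards [Metric.ball_mem_nhds y hr] with z hz
  have hsub : Metric.closedBall y (dist z y) ⊆ Metric.ball y r :=
    Metric.closedBall_subset_ball hz
  have h := (convex_closedBall y (dist z y)).norm_image_sub_le_of_norm_deriv_le (f := g)
    (C := K * dist z y) (fun w hw => (hball w (hsub hw)).1)
    (fun w hw => by
      have hw' := (hball w (hsub hw)).2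
      rw [hy.deriv_eq_zero, sub_zero, ← dist_eq_norm] at hw'
      exact hw'.trans (mul_le_mul_of_nonneg_left hw hK))
    (Metric.mem_closedBall_self dist_nonneg) (Metric.mem_closedBall.2 le_rfl)
  rw [Real.dist_eq, Real.norm_eq_abs, Real.norm_eq_abs, mul_assoc, abs_mul_abs_self, ← sq] at h
  exact h

lemma isLocalMax_add_one_iff {g : ℝ → ℝ} (hper : Function.Periodic g 1) (y : ℝ) :
    IsLocalMax g (y + 1) ↔ IsLocalMax g y := by
  simp only [IsLocalMax, IsMaxFilter]
  rw [← map_add_right_nhds (1 : ℝ) y, Filter.eventually_map]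
  simp only [hper _]

/-- The local maximum points of a `1`-periodic function in two consecutive periods. -/
lemma exists_finset_isLocalMax {g : ℝ → ℝ} (hper : Function.Periodic g 1) {q : ℕ}
    (hcard : {y ∈ Set.Ico (0 : ℝ) 1 | IsLocalMax g y}.encard ≤ (q : ℕ∞)) :
    ∃ T : Finset ℝ, T.card ≤ 2 * q ∧ (∀ y ∈ T, IsLocalMax g y) ∧
      ∀ y ∈ Set.Ico (-1 : ℝ) 1, IsLocalMax g y → y ∈ T := by
  classical
  have hfin := Set.finite_of_encard_le_coe hcard
  set S := hfin.toFinset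
  have hS : ∀ y, y ∈ S ↔ y ∈ Set.Ico (0 : ℝ) 1 ∧ IsLocalMax g y := fun y => by
    simp [S]
  have hSq : S.card ≤ q := by
    rw [hfin.encard_eq_coe_toFinset_card] at hcard
    exact_mod_cast hcard
  refine ⟨S ∪ S.image (· - 1), ?_, ?_, ?_⟩
  · have h1 := Finset.card_union_le S (S.image (· - 1))
    have h2 := Finset.card_image_le (s := S) (f := (· - 1))
    omega
  · intro y hy
    rcases Finset.mem_union.1 hy with h | h
    · exact ((hS y).1 h).2
    · obtain ⟨z, hz, rfl⟩ := Finset.mem_image.1 h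
      rw [← isLocalMax_add_one_iff hper, sub_add_cancel]
      exact ((hS z).1 hz).2
  · intro y hy hmax
    rw [Finset.mem_union]
    by_cases h0 : 0 ≤ y
    · exact Or.inl ((hS y).2 ⟨⟨h0, hy.2⟩, hmax⟩)
    · refine Or.inr (Finset.mem_image.2 ⟨y + 1, (hS _).2 ⟨⟨?_, ?_⟩, ?_⟩, by ring⟩)
      · linarith [hy.1]
      · linarith
      · exact (isLocalMax_add_one_iff hper y).2 hmax

/-- Either the maximum over the window is attained at an endpoint, or it is attained at a local
maximum in the interior. -/
lemma max_sub_gmax_eq_zero_or {g : ℝ → ℝ} (hg : Continuous g) {c t : ℝ} (hc : 0 < c) (ht : 0 < t)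
    (x : ℝ) :
    max (g x) (g (x - c * t)) - gmax g c t x = 0 ∨
      ∃ y ∈ Set.Ioo (x - c * t) x, IsLocalMax g y ∧
        |max (g x) (g (x - c * t)) - gmax g c t x| ≤ |g x - g y| := by
  have hcont : Continuous fun τ => g (x - c * τ) := by fun_prop
  obtain ⟨s, hs, hsup, hle⟩ := isCompact_Icc.exists_sSup_image_eq_and_ge
    (Set.nonempty_Icc.2 ht.le) hcont.continuousOn
  have hgm : gmax g c t x = g (x - c * s) := hsup
  have h0 : g x ≤ g (x - c * s) := by simpa using hle 0 ⟨le_rfl, ht.le⟩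
  have h1 : g (x - c * t) ≤ g (x - c * s) := hle t ⟨ht.le, le_rfl⟩
  rw [hgm]
  rcases hs.1.eq_or_lt with rfl | hs0
  · left
    simp only [mul_zero, sub_zero] at h1 ⊢
    simp [h1]
  rcases hs.2.eq_or_lt with rfl | hst
  · left
    simp [h0]
  right
  have hmem : x - c * s ∈ Set.Ioo (x - c * t) x :=
    ⟨by nlinarith, by nlinarith⟩
  refine ⟨x - c * s, hmem, ?_, ?_⟩
  · filter_upwards [Ioo_mem_nhds hmem.1 hmem.2] with z hz
    have h := hle ((x - z) / c) ⟨div_nonneg (by linarith [hz.2]) hc.le,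
      (div_le_iff₀ hc).2 (by linarith [hz.1])⟩
    rwa [mul_div_cancel₀ _ hc.ne', sub_sub_cancel] at h
  · rw [abs_of_nonpos (by simp [h0, h1]), abs_of_nonpos (by linarith)]
    linarith [le_max_left (g x) (g (x - c * t))]

/-- The `L²` norm of a bounded function supported on finitely many intervals of length `h`. -/
lemma L2norm01_le_of_support {f : ℝ → ℝ} {T : Finset ℝ} {h M : ℝ} (hh : 0 ≤ h) (hM : 0 ≤ M)
    (hf : ∀ x ∈ Set.Ioo (0 : ℝ) 1, f x = 0 ∨ (∃ y ∈ T, x ∈ Set.Ioo y (y + h)) ∧ |f x| ≤ M) :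
    L2norm01 f ≤ M * Real.sqrt (T.card * h) := by
  set B : Set ℝ := ⋃ y ∈ T, Set.Ioo y (y + h)
  have hB : MeasurableSet B := T.measurableSet_biUnion fun _ _ => measurableSet_Ioo
  have hvol : (MeasureTheory.volume.restrict (Set.Ioo (0 : ℝ) 1)).real B ≤ T.card * h := by
    refine (MeasureTheory.measureReal_biUnion_finset_le T _).trans ?_
    refine (Finset.sum_le_card_nsmul T _ h fun y _ => ?_).trans_eq (nsmul_eq_mul _ _)
    rw [MeasureTheory.measureReal_restrict_apply measurableSet_Ioo]
    refine (MeasureTheory.measureReal_mono Set.inter_subset_left (by simp)).trans_eq ?_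
    simp [hh]
  have hint : ∫ x in Set.Ioo (0 : ℝ) 1, (f x) ^ 2 ≤ M ^ 2 * (T.card * h) := by
    calc ∫ x in Set.Ioo (0 : ℝ) 1, (f x) ^ 2
        ≤ ∫ x in Set.Ioo (0 : ℝ) 1, B.indicator (fun _ => M ^ 2) x := by
          refine MeasureTheory.integral_mono_of_nonneg
            (Filter.Eventually.of_forall fun x => sq_nonneg (f x))
            ((MeasureTheory.integrable_const _).indicator hB) ?_
          filter_upwards [MeasureTheory.ae_restrict_mem measurableSet_Ioo] with x hx
          rcases hf x hx with h0 | ⟨⟨y, hy, hxy⟩, hle⟩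
          · simp only [h0]
            exact (by norm_num : (0 : ℝ) ^ 2 = 0).trans_le
              (Set.indicator_nonneg (fun _ _ => sq_nonneg M) x)
          · rw [Set.indicator_of_mem (Set.mem_iUnion₂.2 ⟨y, hy, hxy⟩ : x ∈ B)]
            exact sq_le_sq.2 (hle.trans (le_abs_self M))
      _ ≤ M ^ 2 * (T.card * h) := by
          rw [MeasureTheory.integral_indicator_const _ hB, smul_eq_mul, mul_comm]
          exact mul_le_mul_of_nonneg_left hvol (sq_nonneg M)
  refine (Real.sqrt_le_sqrt hint).trans_eq ?_
  rw [Real.sqrt_mul (sq_nonneg M), Real.sqrt_sq hM]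

/-- Lemma 3.3 of the paper: if `g ∈ Δ²_q` (at most `q` local maxima in `[0,1)`, twice
differentiable at each local maximum), then
`‖max(g(·), g(· - cΔt)) - g_{Δt}‖_{L²(0,1)} ≤ C √q Δt^{5/2}` for all small `Δt > 0`. -/
theorem stmt7 (c : ℝ) (hc : 0 < c) (q : ℕ) (hq : 1 ≤ q)
    (g : ℝ → ℝ) (hg : Continuous g) (hper : Function.Periodic g 1)
    (hcard : {y ∈ Set.Ico (0:ℝ) 1 | IsLocalMax g y}.encard ≤ (q : ℕ∞))
    (htwice : ∀ y, IsLocalMax g y →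
      (∀ᶠ z in nhds y, DifferentiableAt ℝ g z) ∧ DifferentiableAt ℝ (deriv g) y) :
    ∃ C, 0 ≤ C ∧ ∃ δ > (0:ℝ), ∀ dt : ℝ, 0 < dt → dt ≤ δ →
      L2norm01 (fun x => max (g x) (g (x - c * dt)) - gmax g c dt x)
        ≤ C * Real.sqrt q * dt ^ ((5:ℝ)/2) := by
  obtain ⟨T, hTcard, hTmax, hT⟩ := exists_finset_isLocalMax hper hcard
  have hquad : ∀ y ∈ T, ∃ K, 0 ≤ K ∧ ∀ᶠ z in nhds y, |g z - g y| ≤ K * (z - y) ^ 2 :=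
    fun y hy => (hTmax y hy).exists_abs_sub_le_mul_sq (htwice y (hTmax y hy)).1
      (htwice y (hTmax y hy)).2
  choose! K hK0 hK using hquad
  have hshift : ∀ᶠ u in nhds (0 : ℝ), ∀ y ∈ T, |g (y + u) - g y| ≤ K y * u ^ 2 := by
    refine (Filter.eventually_all_finset T).2 fun y hy => ?_
    have ht : Filter.Tendsto (fun u => y + u) (nhds 0) (nhds y) := by
      simpa using (continuous_const_add y).tendsto 0
    filter_upwards [ht.eventually (hK y hy)] with u hu
    simpa using hu
  obtain ⟨r, hr, hball⟩ := Metric.eventually_nhds_iff.1 hshift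
  set L := ∑ y ∈ T, K y
  have hL : 0 ≤ L := Finset.sum_nonneg hK0
  refine ⟨L * c ^ 2 * Real.sqrt (2 * c), by positivity, min r 1 / c, by positivity, ?_⟩
  intro dt hdt hdtδ
  have hh : 0 < c * dt := mul_pos hc hdt
  have hmin : c * dt ≤ min r 1 := by
    rwa [le_div_iff₀ hc, mul_comm] at hdtδ
  have hpow : dt ^ ((5 : ℝ) / 2) = dt ^ 2 * Real.sqrt dt := by
    rw [show (5 : ℝ) / 2 = (2 : ℕ) + 1 / 2 by norm_num, Real.rpow_add hdt, Real.rpow_natCast,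
      ← Real.sqrt_eq_rpow]
  calc L2norm01 (fun x => max (g x) (g (x - c * dt)) - gmax g c dt x)
      ≤ L * (c * dt) ^ 2 * Real.sqrt (T.card * (c * dt)) := by
        refine L2norm01_le_of_support hh.le (by positivity) fun x hx => ?_
        rcases max_sub_gmax_eq_zero_or hg hc hdt x with h0 | ⟨y, hy, hmax, hle⟩
        · exact Or.inl h0
        right
        have hyT : y ∈ T := hT y
          ⟨by linarith [hy.1, hx.1, hmin.trans (min_le_right r 1)], hy.2.trans hx.2⟩ hmax
        have hu0 : 0 ≤ x - y := by linarith [hy.2]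
        have hu1 : x - y < c * dt := by linarith [hy.1]
        refine ⟨⟨y, hyT, hy.2, by linarith⟩, hle.trans ?_⟩
        have hdist : dist (x - y) 0 < r := by
          rw [Real.dist_0_eq_abs, abs_of_nonneg hu0]
          exact hu1.trans_le (hmin.trans (min_le_left r 1))
        have hb := hball hdist y hyT
        rw [add_sub_cancel] at hb
        refine hb.trans (mul_le_mul (Finset.single_le_sum hK0 hyT) ?_ (sq_nonneg _) hL)
        exact pow_le_pow_left₀ hu0 hu1.le 2
    _ ≤ L * (c * dt) ^ 2 * Real.sqrt (2 * c * q * dt) := by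
        have hTq : (T.card : ℝ) ≤ 2 * q := by exact_mod_cast hTcard
        refine mul_le_mul_of_nonneg_left (Real.sqrt_le_sqrt ?_) (by positivity)
        nlinarith
    _ = L * c ^ 2 * Real.sqrt (2 * c) * Real.sqrt q * dt ^ ((5 : ℝ) / 2) := by
        rw [hpow, Real.sqrt_mul (by positivity), Real.sqrt_mul (by positivity)]
        ring
end

section
/- Let c > 0, L_g ≥ 0 and L₁ > L_g. Let g : ℝ → ℝ be continuous, 1-periodic and Lipschitz continuous with constant at most L_g, and let u_0 : ℝ → ℝ be continuous, 1-periodic, and suppose there is a finite set S ⊂ [0,1) with at most p elements such that u_0 is differentiable on ℝ ∖ (S + ℤ) with |u_0'(x)| ≥ L₁ for all x ∉ S + ℤ, with u_0' of constant sign on each connected component of ℝ ∖ (S + ℤ). Define g_t(x) := max_{τ ∈ [0,t]} g(x − cτ). Then there is an integer N (depending only on p) such that for every t ≥ 0 the set { x ∈ [0,1) : g_t(x) = u_0(x − ct) } has at most N elements; in particular, for every t the function x ↦ g_t(x) − u_0(x − ct) has a finitely bounded number of zeros in (0,1), the bound being independent of t. -/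
/-- The set `S + ℤ` of integer translates of points of the finite set `S`. -/
def intTranslates (S : Finset ℝ) : Set ℝ :=
  {x : ℝ | ∃ s ∈ S, ∃ m : ℤ, x = s + (m : ℝ)}

theorem gmax_le_add {g : ℝ → ℝ} {K : ℝ} (hg : Continuous g)
    (hK : ∀ x y, |g x - g y| ≤ K * |x - y|) (c : ℝ) {t : ℝ} (ht : 0 ≤ t) (x y : ℝ) :
    gmax g c t x ≤ gmax g c t y + K * |x - y| := by
  have hbdd : BddAbove ((fun τ => g (y - c * τ)) '' Set.Icc 0 t) :=
    (isCompact_Icc.image (by fun_prop)).bddAbove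
  refine csSup_le ((Set.nonempty_Icc.mpr ht).image _) ?_
  rintro _ ⟨τ, hτ, rfl⟩
  have h1 : g (y - c * τ) ≤ gmax g c t y := le_csSup hbdd ⟨τ, hτ, rfl⟩
  have h2 := (le_abs_self _).trans (hK (x - c * τ) (y - c * τ))
  rw [sub_sub_sub_cancel_right] at h2
  dsimp only
  linarith

theorem abs_gmax_sub_le {g : ℝ → ℝ} {K : ℝ} (hg : Continuous g)
    (hK : ∀ x y, |g x - g y| ≤ K * |x - y|) (c : ℝ) {t : ℝ} (ht : 0 ≤ t) (x y : ℝ) :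
    |gmax g c t x - gmax g c t y| ≤ K * |x - y| := by
  have h1 := gmax_le_add hg hK c ht x y
  have h2 := gmax_le_add hg hK c ht y x
  rw [abs_sub_comm y x] at h2
  exact abs_le.mpr ⟨by linarith, by linarith⟩

theorem exists_mem_Ioo_of_steep {u : ℝ → ℝ} {A : Set ℝ} {K L a b : ℝ} (hKL : K < L)
    (hu : Continuous u) (hd : ∀ x ∉ A, DifferentiableAt ℝ u x ∧ L ≤ |deriv u x|)
    (hab : a < b) (hK : |u b - u a| ≤ K * (b - a)) : ∃ z ∈ A, z ∈ Set.Ioo a b := by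
  by_contra! h
  have hA : ∀ x ∈ Set.Ioo a b, x ∉ A := fun x hx hxA => h x hxA hx
  obtain ⟨ξ, hξ, hslope⟩ := exists_deriv_eq_slope u hab hu.continuousOn
    fun x hx => (hd x (hA x hx)).1.differentiableWithinAt
  have hpos : 0 < b - a := sub_pos.mpr hab
  have h1 := (hd ξ (hA ξ hξ)).2
  rw [hslope, abs_div, abs_of_pos hpos, le_div_iff₀ hpos] at h1
  nlinarith

theorem encard_le_of_separated_by_intTranslates {Z : Set ℝ} {S : Finset ℝ} {p : ℕ} {d : ℝ}
    (hZ : Z ⊆ Set.Ico 0 1) (hS : S.card ≤ p)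
    (hsep : ∀ x ∈ Z, ∀ y ∈ Z, x < y → ∃ z ∈ intTranslates S, z ∈ Set.Ioo (x - d) (y - d)) :
    Z.encard ≤ ((p + 1 : ℕ) : ℕ∞) := by
  by_contra! h
  obtain ⟨T, hTZ, hT⟩ := Set.exists_subset_encard_eq (s := Z) (k := ((p + 1 + 1 : ℕ) : ℕ∞))
    (by simpa using Order.add_one_le_of_lt h)
  lift T to Finset ℝ using Set.finite_of_encard_eq_coe hT
  rw [Set.encard_coe_eq_coe_finsetCard, Nat.cast_inj] at hT
  set e := T.orderEmbOfFin hT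
  have he : ∀ i, e i ∈ Z := fun i => hTZ (T.orderEmbOfFin_mem hT i)
  choose z hz hzI using fun i : Fin (p + 1) =>
    hsep _ (he i.castSucc) _ (he i.succ) (e.strictMono i.castSucc_lt_succ)
  choose s hs m hm using hz
  have hzmono : StrictMono z := fun i j hij =>
    ((hzI i).2.trans_le (sub_le_sub_right (e.monotone (Fin.succ_le_castSucc_iff.mpr hij)) d)).trans
      (hzI j).1
  have hinj : Function.Injective s := by
    intro i j hij
    have hi := hzI i
    have hj := hzI j
    have hi0 := (hZ (he i.castSucc)).1
    have hj0 := (hZ (he j.castSucc)).1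
    have hi1 := (hZ (he i.succ)).2
    have hj1 := (hZ (he j.succ)).2
    have h1 : (m i : ℝ) < m j + 1 := by linarith [hi.2, hj.1, hm i, hm j]
    have h2 : (m j : ℝ) < m i + 1 := by linarith [hj.2, hi.1, hm i, hm j]
    have hmij : m i = m j := by
      norm_cast at h1 h2
      lia
    exact hzmono.injective (by rw [hm i, hm j, hij, hmij])
  have hcard := Finset.card_le_card_of_injOn s (s := Finset.univ) (fun i _ => hs i) hinj.injOn
  rw [Finset.card_univ, Fintype.card_fin] at hcard
  lia

/-- Lemma 3.6 of the paper (no-shattering criterion): if `g` is `1`-periodic and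
Lipschitz with constant `Lg`, and `u₀` is `1`-periodic with `|u₀'| ≥ L₁ > Lg` off a
finite set `S + ℤ` (at most `p` points in `[0,1)`), `u₀'` of constant sign on each
connected component of the complement, then there is `N` depending only on `p` such that
for every `t ≥ 0` the set `{x ∈ [0,1) : g_t(x) = u₀(x - ct)}` has at most `N` elements. -/
theorem stmt9 (p : ℕ) :
    ∃ N : ℕ, ∀ (c Lg L1 : ℝ) (g u0 : ℝ → ℝ) (S : Finset ℝ),
      0 < c → 0 ≤ Lg → Lg < L1 →
      Continuous g → Function.Periodic g 1 →
      (∀ x y, |g x - g y| ≤ Lg * |x - y|) →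
      Continuous u0 → Function.Periodic u0 1 →
      (↑S : Set ℝ) ⊆ Set.Ico (0:ℝ) 1 → S.card ≤ p →
      (∀ x ∉ intTranslates S, DifferentiableAt ℝ u0 x ∧ L1 ≤ |deriv u0 x|) →
      (∀ x ∉ intTranslates S, ∀ y ∉ intTranslates S,
        y ∈ connectedComponentIn (intTranslates S)ᶜ x →
        (0 < deriv u0 x ↔ 0 < deriv u0 y)) →
      ∀ t : ℝ, 0 ≤ t →
        {x ∈ Set.Ico (0:ℝ) 1 | gmax g c t x = u0 (x - c * t)}.encard ≤ (N : ℕ∞) := by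
  refine ⟨p + 1, fun c Lg L1 g u0 S _ _ hL hg _ hgL hu _ _ hS hd _ t ht => ?_⟩
  refine encard_le_of_separated_by_intTranslates (d := c * t) (fun x hx => hx.1) hS ?_
  rintro x ⟨-, hx⟩ y ⟨-, hy⟩ hxy
  refine exists_mem_Ioo_of_steep hL hu hd (sub_lt_sub_right hxy _) ?_
  rw [← hx, ← hy, sub_sub_sub_cancel_right, ← abs_of_pos (sub_pos.mpr hxy)]
  exact abs_gmax_sub_le hg hgL c ht y x
end

section
/- Fix integers k ≥ 0, ℓ ≥ 0, p ≥ 0 and constants L, c_0 ≥ 0, and set q_{k,ℓ} := min(min(k,ℓ)+1, 3/2). Then there exists a constant C ≥ 0, depending only on k, ℓ, p, L, c_0, with the following property: for every partition 0 = x_{1/2} < x_{3/2} < … < x_{N+1/2} = 1 of (0,1) into cells I_j with mesh size h := max_j |I_j|, and for every φ : (0,1) → ℝ in the class C^{ℓ+1}_{p,L,c_0}(0,1), the L²-orthogonal projection Π_h φ of φ onto the space V_h of piecewise polynomials of degree at most k on the partition satisfies ‖φ − Π_h φ‖_{L²(0,1)} ≤ C h^{q_{k,ℓ}}. -/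
/-- A partition `0 = x_{1/2} < x_{3/2} < … < x_{N+1/2} = 1` of `(0,1)` into `N` cells. -/
structure MeshPartition where
  N : ℕ
  hN : 0 < N
  pt : ℕ → ℝ
  h0 : pt 0 = 0
  h1 : pt N = 1
  hmono : ∀ j < N, pt j < pt (j + 1)

/-- The mesh size `h = max_j |I_j|` of a partition. -/
noncomputable def MeshPartition.msize (P : MeshPartition) : ℝ :=
  sSup ((fun j => P.pt (j + 1) - P.pt j) '' Set.Iio P.N)

/-- Membership in the DG space `V_h`: on each cell, `f` agrees with a polynomial of
degree at most `k`. -/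
def InVh (P : MeshPartition) (k : ℕ) (f : ℝ → ℝ) : Prop :=
  ∀ j < P.N, ∃ q : Polynomial ℝ, q.degree ≤ (k : WithBot ℕ) ∧
    ∀ x ∈ Set.Ioo (P.pt j) (P.pt (j + 1)), f x = q.eval x

/-- `φh` is the `L²(0,1)`-orthogonal projection of `φ` onto `V_h`. -/
def IsL2Proj (P : MeshPartition) (k : ℕ) (φ φh : ℝ → ℝ) : Prop :=
  InVh P k φh ∧
    ∀ ψ : ℝ → ℝ, InVh P k ψ →
      ∫ x in Set.Ioo (0:ℝ) 1, (φ x - φh x) * ψ x = 0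

/-- The class `C^{ℓ+1}_{p,L,c₀}(0,1)`: Lipschitz with constant at most `L`, and
`(ℓ+1)`-times continuously differentiable with `|φ^{(ℓ+1)}| ≤ c₀` outside a finite set
of at most `p` points of `(0,1)`. -/
def PiecewiseClass (l p : ℕ) (L c0 : ℝ) (φ : ℝ → ℝ) : Prop :=
  (∀ x ∈ Set.Ioo (0:ℝ) 1, ∀ y ∈ Set.Ioo (0:ℝ) 1, |φ x - φ y| ≤ L * |x - y|) ∧
  ∃ S : Finset ℝ, (↑S : Set ℝ) ⊆ Set.Ioo (0:ℝ) 1 ∧ S.card ≤ p ∧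
    ContDiffOn ℝ (l + 1) φ (Set.Ioo (0:ℝ) 1 \ ↑S) ∧
    ∀ x ∈ Set.Ioo (0:ℝ) 1 \ (↑S : Set ℝ),
      |iteratedDerivWithin (l + 1) φ (Set.Ioo (0:ℝ) 1 \ ↑S) x| ≤ c0

/-- `q_{k,ℓ} = min(min(k,ℓ)+1, 3/2)`. -/
noncomputable def qkl (k l : ℕ) : ℝ :=
  min ((min k l : ℝ) + 1) (3 / 2)

section

open Set MeasureTheory Filter Topology

/-- A monotone function on an open interval changes sign at most once. -/
lemma MonotoneOn.exists_sign_change {f : ℝ → ℝ} {a b : ℝ} (hab : a < b)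
    (hf : MonotoneOn f (Ioo a b)) :
    ∃ t ∈ Icc a b, (∀ x ∈ Ioo a t, f x ≤ 0) ∧ ∀ x ∈ Ioo t b, 0 ≤ f x := by
  set A : Set ℝ := insert a {x | x ∈ Ioo a b ∧ f x ≤ 0} with hA
  have hbdd : BddAbove A := by
    refine ⟨b, ?_⟩
    rintro y (rfl | hy)
    · exact hab.le
    · exact hy.1.2.le
  have hne : A.Nonempty := ⟨a, mem_insert _ _⟩
  have hat : a ≤ sSup A := le_csSup hbdd (mem_insert _ _)
  have htb : sSup A ≤ b := by
    refine csSup_le hne ?_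
    rintro y (rfl | hy)
    · exact hab.le
    · exact hy.1.2.le
  refine ⟨sSup A, ⟨hat, htb⟩, fun x hx => ?_, fun x hx => ?_⟩
  · obtain ⟨y, hy, hxy⟩ := exists_lt_of_lt_csSup hne hx.2
    rcases hy with rfl | hy
    · exact absurd hx.1 (not_lt.2 hxy.le)
    · exact (hf ⟨hx.1, hx.2.trans_le htb⟩ hy.1 hxy.le).trans hy.2
  · by_contra hneg
    have hxA : x ∈ A := Or.inr ⟨⟨hat.trans_lt hx.1, hx.2⟩, (not_le.1 hneg).le⟩
    exact absurd (le_csSup hbdd hxA) (not_le.2 hx.1)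

/-- A function on an open interval whose derivative has constant sign changes sign at most once. -/
lemma exists_sign_change_of_deriv_sign {f f' : ℝ → ℝ} {a b : ℝ} (hab : a < b)
    (hf : ∀ x ∈ Ioo a b, HasDerivAt f (f' x) x)
    (hs : (∀ x ∈ Ioo a b, 0 ≤ f' x) ∨ ∀ x ∈ Ioo a b, f' x ≤ 0) :
    ∃ t ∈ Icc a b, ((∀ x ∈ Ioo a t, 0 ≤ f x) ∨ ∀ x ∈ Ioo a t, f x ≤ 0) ∧
      ((∀ x ∈ Ioo t b, 0 ≤ f x) ∨ ∀ x ∈ Ioo t b, f x ≤ 0) := by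
  have key : ∀ {g g' : ℝ → ℝ}, (∀ x ∈ Ioo a b, HasDerivAt g (g' x) x) →
      (∀ x ∈ Ioo a b, 0 ≤ g' x) → MonotoneOn g (Ioo a b) := by
    intro g g' hg hg'
    refine monotoneOn_of_deriv_nonneg (convex_Ioo a b)
      (fun x hx => (hg x hx).continuousAt.continuousWithinAt) ?_ ?_
    · rw [interior_Ioo]
      exact fun x hx => (hg x hx).differentiableAt.differentiableWithinAt
    · rw [interior_Ioo]
      exact fun x hx => by rw [(hg x hx).deriv]; exact hg' x hx
  rcases hs with hs | hs
  · obtain ⟨t, ht, h1, h2⟩ := (key hf hs).exists_sign_change hab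
    exact ⟨t, ht, Or.inr h1, Or.inl h2⟩
  · have := key (g := fun x => -f x) (g' := fun x => -f' x) (fun x hx => (hf x hx).neg)
      (fun x hx => neg_nonneg.2 (hs x hx))
    obtain ⟨t, ht, h1, h2⟩ := this.exists_sign_change hab
    exact ⟨t, ht, Or.inl fun x hx => neg_nonpos.1 (h1 x hx),
      Or.inr fun x hx => neg_nonneg.1 (h2 x hx)⟩

lemma measure_Ioo_le_add (μ : Measure ℝ) [NullSingletonClass μ] (a b t : ℝ) :
    μ (Ioo a b) ≤ μ (Ioo a t) + μ (Ioo t b) := by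
  have hsub : Ioo a b ⊆ (Ioo a t ∪ Ioo t b) ∪ {t} := by
    intro x hx
    rcases lt_trichotomy x t with h | h | h
    · exact Or.inl (Or.inl ⟨hx.1, h⟩)
    · exact Or.inr h
    · exact Or.inl (Or.inr ⟨h, hx.2⟩)
  calc μ (Ioo a b) ≤ μ ((Ioo a t ∪ Ioo t b) ∪ {t}) := measure_mono hsub
    _ ≤ μ (Ioo a t ∪ Ioo t b) + μ {t} := measure_union_le _ _
    _ = μ (Ioo a t ∪ Ioo t b) := by rw [measure_singleton, add_zero]
    _ ≤ _ := measure_union_le _ _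

/-- If the `m`-th derivative of `D 0` has constant sign on `(a, b)` and `μ` is at most `K` on
subintervals where `D 0` has constant sign, then `μ (a, b) ≤ 2 ^ m * K`. -/
lemma measure_Ioo_le_of_iterated_sign (μ : Measure ℝ) [NullSingletonClass μ] (K : ENNReal)
    (D : ℕ → ℝ → ℝ) (m : ℕ) : ∀ a b : ℝ,
    (∀ i < m, ∀ x ∈ Ioo a b, HasDerivAt (D i) (D (i + 1) x) x) →
    ((∀ x ∈ Ioo a b, 0 ≤ D m x) ∨ ∀ x ∈ Ioo a b, D m x ≤ 0) →
    (∀ c d, Ioo c d ⊆ Ioo a b → ((∀ x ∈ Ioo c d, 0 ≤ D 0 x) ∨ ∀ x ∈ Ioo c d, D 0 x ≤ 0) →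
      μ (Ioo c d) ≤ K) →
    μ (Ioo a b) ≤ 2 ^ m * K := by
  induction m with
  | zero =>
    intro a b _ hs hK
    simpa using hK a b Subset.rfl hs
  | succ m ih =>
    intro a b hD hs hK
    rcases le_or_gt b a with hba | hab
    · simp [Ioo_eq_empty (not_lt.2 hba)]
    obtain ⟨t, ht, h1, h2⟩ := exists_sign_change_of_deriv_sign hab (hD m m.lt_succ_self) hs
    have s1 : Ioo a t ⊆ Ioo a b := Ioo_subset_Ioo_right ht.2
    have s2 : Ioo t b ⊆ Ioo a b := Ioo_subset_Ioo_left ht.1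
    have e1 := ih a t (fun i hi x hx => hD i (hi.trans m.lt_succ_self) x (s1 hx)) h1
      (fun c d hcd => hK c d (hcd.trans s1))
    have e2 := ih t b (fun i hi x hx => hD i (hi.trans m.lt_succ_self) x (s2 hx)) h2
      (fun c d hcd => hK c d (hcd.trans s2))
    calc μ (Ioo a b) ≤ _ := measure_Ioo_le_add μ a b t
      _ ≤ 2 ^ m * K + 2 ^ m * K := add_le_add e1 e2
      _ = 2 ^ (m + 1) * K := by ring

/-- If `μ` is at most `K` on every subinterval of `(a, b)` avoiding the finite set `S`, then
`μ (a, b) ≤ 2 ^ #S * K`. -/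
lemma measure_Ioo_le_of_finset (μ : Measure ℝ) [NullSingletonClass μ] (K : ENNReal)
    (S : Finset ℝ) : ∀ a b : ℝ,
    (∀ c d, Ioo c d ⊆ Ioo a b → Disjoint (Ioo c d) (S : Set ℝ) → μ (Ioo c d) ≤ K) →
    μ (Ioo a b) ≤ 2 ^ S.card * K := by
  induction S using Finset.induction_on with
  | empty =>
    intro a b hK
    simpa using hK a b Subset.rfl (by simp)
  | insert t S ht ih =>
    intro a b hK
    by_cases htab : t ∈ Ioo a b
    · have s1 : Ioo a t ⊆ Ioo a b := Ioo_subset_Ioo_right htab.2.le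
      have s2 : Ioo t b ⊆ Ioo a b := Ioo_subset_Ioo_left htab.1.le
      have e1 := ih a t (fun c d hcd hdis => hK c d (hcd.trans s1) (by
        rw [Finset.coe_insert, Set.disjoint_insert_right]
        exact ⟨fun h => lt_irrefl _ (hcd h).2, hdis⟩))
      have e2 := ih t b (fun c d hcd hdis => hK c d (hcd.trans s2) (by
        rw [Finset.coe_insert, Set.disjoint_insert_right]
        exact ⟨fun h => lt_irrefl _ (hcd h).1, hdis⟩))
      rw [Finset.card_insert_of_notMem ht]
      calc μ (Ioo a b) ≤ _ := measure_Ioo_le_add μ a b t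
        _ ≤ 2 ^ S.card * K + 2 ^ S.card * K := add_le_add e1 e2
        _ = 2 ^ (S.card + 1) * K := by ring
    · refine (ih a b fun c d hcd hdis => hK c d hcd ?_).trans ?_
      · rw [Finset.coe_insert, Set.disjoint_insert_right]
        exact ⟨fun h => htab (hcd h), hdis⟩
      · gcongr
        · norm_num
        · exact Finset.subset_insert t S

/-- The total variation of a bounded monotone function on an open interval. -/
lemma lintegral_enorm_deriv_le_of_sign {G H : ℝ → ℝ} {c d M : ℝ}
    (hG : ∀ x ∈ Ioo c d, HasDerivAt G (H x) x) (hH : ContinuousOn H (Ioo c d))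
    (hs : (∀ x ∈ Ioo c d, 0 ≤ H x) ∨ ∀ x ∈ Ioo c d, H x ≤ 0)
    (hM : ∀ x ∈ Ioo c d, |G x| ≤ M) :
    ∫⁻ x in Ioo c d, ‖H x‖ₑ ≤ ENNReal.ofReal (2 * M) := by
  wlog hpos : ∀ x ∈ Ioo c d, 0 ≤ H x generalizing G H
  · have hneg := hs.resolve_left hpos
    have := this (G := fun x => -G x) (H := fun x => -H x) (fun x hx => (hG x hx).neg) hH.neg
      (Or.inl fun x hx => neg_nonneg.2 (hneg x hx)) (fun x hx => by rw [abs_neg]; exact hM x hx)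
      (fun x hx => neg_nonneg.2 (hneg x hx))
    simpa only [enorm_neg] using this
  rcases le_or_gt d c with hdc | hcd
  · simp [Ioo_eq_empty (not_lt.2 hdc)]
  obtain ⟨u, -, hu, hut⟩ := exists_seq_strictAnti_tendsto' hcd
  obtain ⟨v, -, hv, hvt⟩ := exists_seq_strictMono_tendsto' hcd
  have hcov : AECover (volume.restrict (Ioo c d)) atTop fun i => Icc (u i) (v i) :=
    aecover_Ioo_of_Icc hut hvt
  refine le_of_tendsto' (hcov.lintegral_tendsto_of_nat
    (hH.aestronglyMeasurable measurableSet_Ioo).enorm) fun n => ?_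
  rw [Measure.restrict_restrict measurableSet_Icc]
  have hsub : Icc (u n) (v n) ⊆ Ioo c d := fun x hx =>
    ⟨(hu n).1.trans_le hx.1, hx.2.trans_lt (hv n).2⟩
  rw [inter_eq_left.2 hsub]
  rcases lt_or_ge (v n) (u n) with huv | huv
  · simp [Icc_eq_empty (not_le.2 huv)]
  have hint : IntervalIntegrable H volume (u n) (v n) := by
    apply ContinuousOn.intervalIntegrable
    rw [uIcc_of_le huv]
    exact hH.mono hsub
  have hInt : IntegrableOn H (Icc (u n) (v n)) := (hH.mono hsub).integrableOn_Icc
  have hval := intervalIntegral.integral_eq_sub_of_hasDerivAt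
    (fun x hx => hG x (hsub (by rwa [uIcc_of_le huv] at hx))) hint
  rw [intervalIntegral.integral_of_le huv, ← integral_Icc_eq_integral_Ioc] at hval
  have hnn : 0 ≤ᵐ[volume.restrict (Icc (u n) (v n))] H :=
    (ae_restrict_iff' measurableSet_Icc).2 (Eventually.of_forall fun x hx => hpos x (hsub hx))
  have e : ∫⁻ x in Icc (u n) (v n), ‖H x‖ₑ = ∫⁻ x in Icc (u n) (v n), ENNReal.ofReal (H x) :=
    setLIntegral_congr_fun measurableSet_Icc fun x hx =>
      Real.enorm_eq_ofReal (hpos x (hsub hx))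
  rw [e, ← ofReal_integral_eq_lintegral_ofReal hInt hnn, hval]
  apply ENNReal.ofReal_le_ofReal
  have h1 := abs_le.1 (hM _ (hsub (left_mem_Icc.2 huv)))
  have h2 := abs_le.1 (hM _ (hsub (right_mem_Icc.2 huv)))
  linarith [h1.1, h2.2]

lemma hasDerivAt_const_mul_pow_div_factorial (c x : ℝ) (r : ℕ) :
    HasDerivAt (fun y : ℝ => c * (y ^ (r + 1) / ((r + 1).factorial : ℝ)))
      (c * (x ^ r / (r.factorial : ℝ))) x := by
  have h := (((hasDerivAt_pow (r + 1) x).div_const ((r + 1).factorial : ℝ)).const_mul c)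
  refine h.congr_deriv ?_
  have h1 : (r.factorial : ℝ) ≠ 0 := by positivity
  rw [Nat.factorial_succ]
  push_cast
  field_simp

/-- A first derivative bounded by `L` and an `(n + 2)`-nd derivative bounded by `c₀` control the
`L¹` norm of the second derivative, uniformly in the length of the interval. -/
lemma lintegral_enorm_second_deriv_le (D : ℕ → ℝ → ℝ) (n : ℕ) {a b L c₀ : ℝ} (ha : 0 ≤ a)
    (hb : b ≤ 1) (hL : 0 ≤ L) (hc₀ : 0 ≤ c₀)
    (hD : ∀ i < n + 2, ∀ x ∈ Ioo a b, HasDerivAt (D i) (D (i + 1) x) x)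
    (hcont : ContinuousOn (D 2) (Ioo a b)) (h1 : ∀ x ∈ Ioo a b, |D 1 x| ≤ L)
    (hn : ∀ x ∈ Ioo a b, |D (n + 2) x| ≤ c₀) :
    ∫⁻ x in Ioo a b, ‖D 2 x‖ₑ ≤ 2 ^ n * ENNReal.ofReal (2 * (L + c₀) + c₀) := by
  set q : ℕ → ℝ → ℝ := fun i x => c₀ * (x ^ (n + 2 - i) / ((n + 2 - i).factorial : ℝ)) with hq
  have hq_deriv : ∀ i < n + 2, ∀ x, HasDerivAt (q i) (q (i + 1) x) x := by
    intro i hi x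
    obtain ⟨r, hr⟩ : ∃ r, n + 2 - i = r + 1 := ⟨n + 1 - i, by omega⟩
    have hr' : n + 2 - (i + 1) = r := by omega
    simp only [hq, hr, hr']
    exact hasDerivAt_const_mul_pow_div_factorial c₀ x r
  have hq_cont : ∀ i, Continuous (q i) := fun i => by simp only [hq]; fun_prop
  have hq_bound : ∀ i, ∀ x ∈ Ioo a b, |q i x| ≤ c₀ := by
    intro i x hx
    have hx0 : 0 ≤ x := ha.trans hx.1.le
    have hx1 : x ≤ 1 := hx.2.le.trans hb
    have hnn : 0 ≤ q i x := by simp only [hq]; positivity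
    rw [abs_of_nonneg hnn]
    simp only [hq]
    refine mul_le_of_le_one_right hc₀ (div_le_one_of_le₀ ?_ (by positivity))
    exact (pow_le_one₀ hx0 hx1).trans
      (by exact_mod_cast Nat.one_le_iff_ne_zero.2 (Nat.factorial_ne_zero _))
  set ν : Measure ℝ := volume.withDensity fun x => ‖D 2 x‖ₑ with hν
  have hνI : ∀ c d, ν (Ioo c d) = ∫⁻ x in Ioo c d, ‖D 2 x‖ₑ := fun c d =>
    withDensity_apply _ measurableSet_Ioo
  rw [← hνI]
  refine measure_Ioo_le_of_iterated_sign ν _ (fun i x => D (i + 2) x + q (i + 2) x) n a b ?_ ?_ ?_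
  · intro i hi x hx
    rcases Nat.lt_or_ge (i + 2) (n + 2) with h | h
    · exact (hD (i + 2) h x hx).add (hq_deriv (i + 2) h x)
    · omega
  · left
    intro x hx
    have : q (n + 2) x = c₀ := by simp [hq]
    rw [this]
    linarith [(abs_le.1 (hn x hx)).1]
  · intro c d hcd hs
    rw [hνI]
    have hEb : ∫⁻ x in Ioo c d, ‖D 2 x + q 2 x‖ₑ ≤ ENNReal.ofReal (2 * (L + c₀)) := by
      refine lintegral_enorm_deriv_le_of_sign (G := fun x => D 1 x + q 1 x)
        (fun x hx => (hD 1 (by omega) x (hcd hx)).add (hq_deriv 1 (by omega) x))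
        ((hcont.mono hcd).add (hq_cont 2).continuousOn) hs fun x hx => ?_
      exact (abs_add_le _ _).trans (add_le_add (h1 x (hcd hx)) (hq_bound 1 x (hcd hx)))
    have hqb : ∫⁻ x in Ioo c d, ‖q 2 x‖ₑ ≤ ENNReal.ofReal c₀ := by
      calc ∫⁻ x in Ioo c d, ‖q 2 x‖ₑ ≤ ∫⁻ _ in Ioo c d, ENNReal.ofReal c₀ := by
            refine setLIntegral_mono measurable_const fun x hx => ?_
            rw [Real.enorm_eq_ofReal_abs]
            exact ENNReal.ofReal_le_ofReal (hq_bound 2 x (hcd hx))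
        _ = ENNReal.ofReal c₀ * volume (Ioo c d) := setLIntegral_const _ _
        _ ≤ ENNReal.ofReal c₀ * 1 := by
            gcongr
            refine (measure_mono hcd).trans ?_
            rw [Real.volume_Ioo]
            exact ENNReal.ofReal_le_one.2 (by linarith)
        _ = _ := mul_one _
    calc ∫⁻ x in Ioo c d, ‖D 2 x‖ₑ
        ≤ ∫⁻ x in Ioo c d, (‖D 2 x + q 2 x‖ₑ + ‖q 2 x‖ₑ) := by
          refine lintegral_mono fun x => ?_
          have h : D 2 x = (D 2 x + q 2 x) - q 2 x := by ring
          calc ‖D 2 x‖ₑ = ‖(D 2 x + q 2 x) - q 2 x‖ₑ := by rw [← h]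
            _ ≤ _ := enorm_sub_le
      _ = (∫⁻ x in Ioo c d, ‖D 2 x + q 2 x‖ₑ) + ∫⁻ x in Ioo c d, ‖q 2 x‖ₑ :=
          lintegral_add_right _ (hq_cont 2).measurable.enorm
      _ ≤ _ := add_le_add hEb hqb
      _ = ENNReal.ofReal (2 * (L + c₀) + c₀) := by
          rw [ENNReal.ofReal_add (by positivity) hc₀]

/-- On an interval where `φ' = g` and `g' = H`, the tangent line at `m` approximates `φ` to within
the length of the interval times both `2 L` and the variation of `g`. -/
lemma sq_sub_tangent_le {φ g H : ℝ → ℝ} {a b L V : ℝ} (hab : a < b)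
    (hφ : ∀ x ∈ Ioo a b, HasDerivAt φ (g x) x) (hg : ∀ x ∈ Ioo a b, HasDerivAt g (H x) x)
    (hH : ContinuousOn H (Ioo a b)) (hL : ∀ x ∈ Ioo a b, |g x| ≤ L) (hV : 0 ≤ V)
    (hHV : ∫⁻ x in Ioo a b, ‖H x‖ₑ ≤ ENNReal.ofReal V) {m x : ℝ} (hm : m ∈ Ioo a b)
    (hx : x ∈ Ioo a b) :
    (φ x - (φ m + g m * (x - m))) ^ 2 ≤ (b - a) ^ 2 * (2 * L * V) := by
  have hosc : ∀ y ∈ Ioo a b, |g y - g m| ≤ V := by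
    intro y hy
    have hsub : uIcc m y ⊆ Ioo a b := ordConnected_Ioo.uIcc_subset hm hy
    have hval := intervalIntegral.integral_eq_sub_of_hasDerivAt
      (fun z hz => hg z (hsub hz)) (hH.mono hsub).intervalIntegrable
    rw [← hval, ← Real.norm_eq_abs, intervalIntegral.norm_intervalIntegral_eq]
    have h2 : ‖∫ z in uIoc m y, H z‖ₑ ≤ ENNReal.ofReal V :=
      (enorm_integral_le_lintegral_enorm _).trans
        ((lintegral_mono_set (uIoc_subset_uIcc.trans hsub)).trans hHV)
    rwa [← ofReal_norm, ENNReal.ofReal_le_ofReal_iff hV] at h2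
  have hest : ∀ W, (∀ y ∈ Ioo a b, |g y - g m| ≤ W) →
      |φ x - (φ m + g m * (x - m))| ≤ W * (b - a) := by
    intro W hW
    have h := Convex.norm_image_sub_le_of_norm_hasDerivWithin_le (𝕜 := ℝ)
      (f := fun y => φ y - g m * y) (f' := fun y => g y - g m) (C := W)
      (fun y hy => ((hφ y hy).sub
        (by simpa using (hasDerivAt_id y).const_mul (g m))).hasDerivWithinAt)
      hW (convex_Ioo a b) hm hx
    have hW0 : 0 ≤ W := (abs_nonneg _).trans (hW m hm)
    calc |φ x - (φ m + g m * (x - m))| = ‖φ x - g m * x - (φ m - g m * m)‖ := by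
          rw [Real.norm_eq_abs]; congr 1; ring
      _ ≤ W * ‖x - m‖ := h
      _ ≤ W * (b - a) := by
          gcongr
          rw [Real.norm_eq_abs, abs_le]
          constructor <;> linarith [hx.1, hx.2, hm.1, hm.2]
  have e1 := hest V hosc
  have e2 := hest (2 * L) fun y hy => by
    rw [abs_le]
    have := abs_le.1 (hL y hy)
    have := abs_le.1 (hL m hm)
    constructor <;> linarith [this.1, this.2]
  have hL0 : 0 ≤ L := (abs_nonneg _).trans (hL m hm)
  rw [← sq_abs, sq]
  calc _ ≤ (2 * L * (b - a)) * (V * (b - a)) :=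
        mul_le_mul e2 e1 (abs_nonneg _) (by have := sub_pos.2 hab; positivity)
    _ = _ := by ring

namespace MeshPartition

variable (P : MeshPartition)

/-- The `j`-th open cell of a partition. -/
def cell (j : ℕ) : Set ℝ := Ioo (P.pt j) (P.pt (j + 1))

lemma pt_le_pt {i j : ℕ} (hij : i ≤ j) (hj : j ≤ P.N) : P.pt i ≤ P.pt j := by
  induction j, hij using Nat.le_induction with
  | base => exact le_rfl
  | succ j _ ih => exact (ih (by omega)).trans (P.hmono j (by omega)).le

lemma cell_subset {j : ℕ} (hj : j < P.N) : P.cell j ⊆ Ioo 0 1 := by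
  have h0 := P.pt_le_pt (Nat.zero_le j) hj.le
  have h1 := P.pt_le_pt (Nat.succ_le_of_lt hj) le_rfl
  rw [P.h0] at h0
  rw [P.h1] at h1
  exact Ioo_subset_Ioo h0 h1

lemma disjoint_cell_of_lt {i j : ℕ} (hij : i < j) (hj : j < P.N) :
    Disjoint (P.cell i) (P.cell j) := by
  rw [Set.disjoint_left]
  intro x hx hx'
  have := P.pt_le_pt (Nat.succ_le_of_lt hij) hj.le
  exact absurd hx'.1 (not_lt.2 (hx.2.le.trans this))

lemma pairwiseDisjoint_cell :
    ((Finset.range P.N : Finset ℕ) : Set ℕ).PairwiseDisjoint P.cell := by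
  intro i hi j hj hij
  simp only [Finset.coe_range, mem_Iio] at hi hj
  rcases lt_or_gt_of_ne hij with h | h
  · exact P.disjoint_cell_of_lt h hj
  · exact (P.disjoint_cell_of_lt h hi).symm

lemma length_le_msize {j : ℕ} (hj : j < P.N) : P.pt (j + 1) - P.pt j ≤ P.msize :=
  le_csSup ((finite_Iio P.N).image _).bddAbove (mem_image_of_mem _ hj)

lemma msize_nonneg : 0 ≤ P.msize :=
  (sub_pos.2 (P.hmono 0 P.hN)).le.trans (P.length_le_msize P.hN)

lemma sum_length : ∑ j ∈ Finset.range P.N, (P.pt (j + 1) - P.pt j) = 1 := by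
  rw [Finset.sum_range_sub, P.h0, P.h1, sub_zero]

lemma sum_measure_cell_le (μ : Measure ℝ) :
    ∑ j ∈ Finset.range P.N, μ (P.cell j) ≤ μ (Ioo 0 1) := by
  rw [← measure_biUnion_finset P.pairwiseDisjoint_cell fun _ _ => measurableSet_Ioo]
  exact measure_mono (iUnion₂_subset fun j hj => P.cell_subset (Finset.mem_range.1 hj))

/-- A function is tame if it is continuous and bounded on every cell. -/
def Tame (f : ℝ → ℝ) : Prop :=
  ∀ j < P.N, ContinuousOn f (P.cell j) ∧ ∃ B, ∀ x ∈ P.cell j, |f x| ≤ B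

variable {P}

lemma Tame.sub {f g : ℝ → ℝ} (hf : P.Tame f) (hg : P.Tame g) : P.Tame fun x => f x - g x := by
  intro j hj
  obtain ⟨cf, A, hA⟩ := hf j hj
  obtain ⟨cg, B, hB⟩ := hg j hj
  exact ⟨cf.sub cg, A + B, fun x hx => (abs_sub _ _).trans (add_le_add (hA x hx) (hB x hx))⟩

lemma Tame.mul {f g : ℝ → ℝ} (hf : P.Tame f) (hg : P.Tame g) : P.Tame fun x => f x * g x := by
  intro j hj
  obtain ⟨cf, A, hA⟩ := hf j hj
  obtain ⟨cg, B, hB⟩ := hg j hj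
  refine ⟨cf.mul cg, A * B, fun x hx => ?_⟩
  rw [abs_mul]
  exact mul_le_mul (hA x hx) (hB x hx) (abs_nonneg _) ((abs_nonneg _).trans (hA x hx))

lemma Tame.intervalIntegrable_cell {f : ℝ → ℝ} (hf : P.Tame f) {j : ℕ} (hj : j < P.N) :
    IntervalIntegrable f volume (P.pt j) (P.pt (j + 1)) := by
  obtain ⟨cf, B, hB⟩ := hf j hj
  rw [intervalIntegrable_iff_integrableOn_Ioo_of_le (P.hmono j hj).le]
  have : IsFiniteMeasure (volume.restrict (Ioo (P.pt j) (P.pt (j + 1)))) :=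
    ⟨by rw [Measure.restrict_apply_univ]; exact measure_Ioo_lt_top⟩
  exact Integrable.of_bound (cf.aestronglyMeasurable measurableSet_Ioo) B
    ((ae_restrict_iff' measurableSet_Ioo).2 (Eventually.of_forall hB))

lemma Tame.integrableOn {f : ℝ → ℝ} (hf : P.Tame f) : IntegrableOn f (Ioo 0 1) := by
  have h := IntervalIntegrable.trans_iterate (a := P.pt) (n := P.N) (μ := volume) (f := f)
    fun j hj => hf.intervalIntegrable_cell hj
  rwa [P.h0, P.h1, intervalIntegrable_iff_integrableOn_Ioo_of_le zero_le_one] at h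

lemma Tame.integral_le_sum {f : ℝ → ℝ} (hf : P.Tame f) {B : ℕ → ℝ}
    (hB : ∀ j < P.N, ∀ x ∈ P.cell j, f x ≤ B j) :
    ∫ x in Ioo (0 : ℝ) 1, f x ≤ ∑ j ∈ Finset.range P.N, B j * (P.pt (j + 1) - P.pt j) := by
  have h := intervalIntegral.sum_integral_adjacent_intervals (a := P.pt) (n := P.N)
    (μ := volume) (f := f) fun j hj => hf.intervalIntegrable_cell hj
  rw [P.h0, P.h1, intervalIntegral.integral_of_le zero_le_one, integral_Ioc_eq_integral_Ioo] at h
  rw [← h]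
  refine Finset.sum_le_sum fun j hj => ?_
  rw [Finset.mem_range] at hj
  refine (intervalIntegral.integral_mono_on_of_le_Ioo (P.hmono j hj).le
    (hf.intervalIntegrable_cell hj) intervalIntegrable_const (hB j hj)).trans ?_
  rw [intervalIntegral.integral_const, smul_eq_mul, mul_comm]

lemma tame_of_inVh {k : ℕ} {f : ℝ → ℝ} (hf : InVh P k f) : P.Tame f := by
  intro j hj
  obtain ⟨q, -, hq⟩ := hf j hj
  refine ⟨q.continuous.continuousOn.congr hq, ?_⟩
  obtain ⟨B, hB⟩ := isCompact_Icc.exists_bound_of_continuousOn (s := Icc (P.pt j) (P.pt (j + 1)))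
    q.continuous.continuousOn
  exact ⟨B, fun x hx => by rw [hq x hx]; exact hB x (Ioo_subset_Icc_self hx)⟩

lemma tame_of_lipschitz {L : ℝ} {φ : ℝ → ℝ}
    (hφ : ∀ x ∈ Ioo (0 : ℝ) 1, ∀ y ∈ Ioo (0 : ℝ) 1, |φ x - φ y| ≤ L * |x - y|) : P.Tame φ := by
  intro j hj
  have hsub := P.cell_subset hj
  constructor
  · have : LipschitzOnWith L.toNNReal φ (Ioo 0 1) := by
      refine LipschitzOnWith.of_dist_le_mul fun x hx y hy => ?_
      rw [Real.dist_eq, Real.dist_eq]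
      exact (hφ x hx y hy).trans (by gcongr; exact Real.le_coe_toNNReal L)
    exact this.continuousOn.mono hsub
  · refine ⟨|φ (1 / 2)| + |L|, fun x hx => ?_⟩
    have hx := hsub hx
    have h := hφ x hx (1 / 2) ⟨by norm_num, by norm_num⟩
    have h1 : |x - 1 / 2| ≤ 1 := by rw [abs_le]; constructor <;> linarith [hx.1, hx.2]
    have h2 : L * |x - 1 / 2| ≤ |L| * 1 :=
      mul_le_mul (le_abs_self L) h1 (abs_nonneg _) (abs_nonneg _)
    have h3 := abs_sub_abs_le_abs_sub (φ x) (φ (1 / 2))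
    linarith

lemma inVh_sub {k : ℕ} {f g : ℝ → ℝ} (hf : InVh P k f) (hg : InVh P k g) :
    InVh P k fun x => f x - g x := by
  intro j hj
  obtain ⟨q, hq, hqf⟩ := hf j hj
  obtain ⟨r, hr, hrg⟩ := hg j hj
  refine ⟨q - r, (Polynomial.degree_sub_le q r).trans (max_le hq hr), fun x hx => ?_⟩
  rw [Polynomial.eval_sub, ← hqf x hx, ← hrg x hx]

/-- Any choice of polynomials of degree at most `k` on the cells comes from an element of `V_h`. -/
lemma exists_inVh {k : ℕ} (q : ℕ → Polynomial ℝ) (hq : ∀ j, (q j).degree ≤ (k : WithBot ℕ)) :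
    ∃ ψ, InVh P k ψ ∧ ∀ j < P.N, ∀ x ∈ P.cell j, ψ x = (q j).eval x := by
  have key : ∀ j < P.N, ∀ x ∈ P.cell j,
      ∑ i ∈ Finset.range P.N, (P.cell i).indicator (fun y => (q i).eval y) x = (q j).eval x := by
    intro j hj x hx
    rw [Finset.sum_eq_single j, indicator_of_mem hx]
    · intro i hi hij
      refine indicator_of_notMem (fun hxi => ?_) _
      exact Set.disjoint_left.1
        (P.pairwiseDisjoint_cell (Finset.mem_coe.2 hi) (by simpa using hj) hij) hxi hx
    · exact fun h => absurd (Finset.mem_range.2 hj) h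
  exact ⟨_, fun j hj => ⟨q j, hq j, key j hj⟩, key⟩

/-- The projection is a best approximation: piecewise polynomial error bounds on the cells bound
the projection error. -/
lemma integral_sq_sub_proj_le {k : ℕ} {φ φh : ℝ → ℝ} (hφ : P.Tame φ) (hproj : IsL2Proj P k φ φh)
    (q : ℕ → Polynomial ℝ) (hq : ∀ j, (q j).degree ≤ (k : WithBot ℕ)) {B : ℕ → ℝ}
    (hB : ∀ j < P.N, ∀ x ∈ P.cell j, (φ x - (q j).eval x) ^ 2 ≤ B j) :
    ∫ x in Ioo (0 : ℝ) 1, (φ x - φh x) ^ 2 ≤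
      ∑ j ∈ Finset.range P.N, B j * (P.pt (j + 1) - P.pt j) := by
  obtain ⟨ψ, hψ, hψq⟩ := exists_inVh (P := P) q hq
  have te := hφ.sub (tame_of_inVh hproj.1)
  have td := hφ.sub (tame_of_inVh hψ)
  have tw := tame_of_inVh (inVh_sub hψ hproj.1)
  have te2 : Integrable (fun x => (φ x - φh x) ^ 2) (volume.restrict (Ioo 0 1)) :=
    (te.mul te).integrableOn.congr (Eventually.of_forall fun x => (sq _).symm)
  have horth := hproj.2 _ (inVh_sub hψ hproj.1)
  refine le_trans ?_ ((td.mul td).integral_le_sum (B := B) fun j hj x hx => ?_)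
  · have hle : ∫ x in Ioo (0 : ℝ) 1, (φ x - φh x) ^ 2 - 2 * ((φ x - φh x) * (ψ x - φh x)) ≤
        ∫ x in Ioo (0 : ℝ) 1, (φ x - ψ x) * (φ x - ψ x) := by
      refine integral_mono ?_ (td.mul td).integrableOn fun x => ?_
      · exact te2.sub ((te.mul tw).integrableOn.const_mul 2)
      · simp only
        nlinarith [sq_nonneg (ψ x - φh x)]
    rw [integral_sub te2 ((te.mul tw).integrableOn.const_mul 2), integral_const_mul, horth] at hle
    simpa using hle
  · rw [hψq j hj x hx, ← sq]
    exact hB j hj x hx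

end MeshPartition

/-- A function of the piecewise class admits a finite measure controlling the squared error of a
suitable affine approximation on every subinterval. It charges the breakpoints and has density
`|φ''|` elsewhere. -/
lemma exists_measure_controlling_affine_error {n p : ℕ} {L c₀ : ℝ} (hL : 0 ≤ L) (hc₀ : 0 ≤ c₀)
    {φ : ℝ → ℝ} (hφ : PiecewiseClass (n + 1) p L c₀ φ) :
    ∃ μ : Measure ℝ,
      μ (Ioo 0 1) ≤ ENNReal.ofReal (2 ^ p * (2 ^ n * (2 * (L + c₀) + c₀)) + p) ∧
      ∀ a b, a < b → Ioo a b ⊆ Ioo 0 1 → ∃ q : Polynomial ℝ, q.degree ≤ 1 ∧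
        ∀ x ∈ Ioo a b,
          (φ x - q.eval x) ^ 2 ≤ (b - a) ^ 2 * ((2 * L + L ^ 2) * μ.real (Ioo a b)) := by
  obtain ⟨hlip, S, hS, hcard, hsmooth, hbound⟩ := hφ
  set Ω : Set ℝ := Ioo (0 : ℝ) 1 \ S with hΩ
  have hopen : IsOpen Ω := isOpen_Ioo.sdiff S.finite_toSet.isClosed
  set D : ℕ → ℝ → ℝ := fun i => iteratedDerivWithin i φ Ω with hDdef
  have hD : ∀ i < n + 2, ∀ x ∈ Ω, HasDerivAt (D i) (D (i + 1) x) x := by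
    intro i hi x hx
    have hdiff := hsmooth.differentiableOn_iteratedDerivWithin (m := i)
      (by exact_mod_cast hi) hopen.uniqueDiffOn
    have h := (hdiff x hx).hasDerivWithinAt.hasDerivAt (hopen.mem_nhds hx)
    simpa only [hDdef, iteratedDerivWithin_succ] using h
  have hD0 : D 0 = φ := iteratedDerivWithin_zero
  have hcont : ContinuousOn (D 2) Ω :=
    hsmooth.continuousOn_iteratedDerivWithin (by norm_cast; omega) hopen.uniqueDiffOn
  have hD1 : ∀ x ∈ Ω, |D 1 x| ≤ L := by
    intro x hx
    have h := hD 0 (by omega) x hx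
    rw [hD0] at h
    refine h.le_of_lip' hL ?_
    filter_upwards [isOpen_Ioo.mem_nhds hx.1] with y hy
    exact hlip y hy x hx.1
  set ν : Measure ℝ := volume.withDensity fun x => ‖D 2 x‖ₑ with hν
  have hνI : ∀ c d, ν (Ioo c d) = ∫⁻ x in Ioo c d, ‖D 2 x‖ₑ := fun c d =>
    withDensity_apply _ measurableSet_Ioo
  have hνle : ν (Ioo 0 1) ≤ 2 ^ S.card * (2 ^ n * ENNReal.ofReal (2 * (L + c₀) + c₀)) := by
    refine measure_Ioo_le_of_finset ν _ S 0 1 fun c d hcd hdis => ?_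
    have hsub : Ioo c d ⊆ Ω := fun x hx => ⟨hcd hx, Set.disjoint_left.1 hdis hx⟩
    rw [hνI]
    rcases le_or_gt d c with hdc | hlt
    · simp [Ioo_eq_empty (not_lt.2 hdc)]
    have hends := (Ioo_subset_Ioo_iff hlt).1 hcd
    exact lintegral_enorm_second_deriv_le D n hends.1 hends.2 hL hc₀
      (fun i hi x hx => hD i hi x (hsub hx)) (hcont.mono hsub) (fun x hx => hD1 x (hsub hx))
      (fun x hx => hbound x (hsub hx))
  set δ : Measure ℝ := ∑ s ∈ S, Measure.dirac s with hδ
  have hδle : ∀ A, δ A ≤ S.card := by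
    intro A
    rw [hδ, Measure.finsetSum_apply]
    calc ∑ s ∈ S, Measure.dirac s A ≤ ∑ _s ∈ S, (1 : ENNReal) :=
          Finset.sum_le_sum fun s _ => prob_le_one
      _ = S.card := by simp
  have htotal : (ν + δ) (Ioo 0 1) ≤
      ENNReal.ofReal (2 ^ p * (2 ^ n * (2 * (L + c₀) + c₀)) + p) := by
    rw [Measure.add_apply, ENNReal.ofReal_add (by positivity) (by positivity),
      ENNReal.ofReal_mul (by positivity), ENNReal.ofReal_mul (by positivity),
      ENNReal.ofReal_pow (by positivity), ENNReal.ofReal_pow (by positivity),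
      ENNReal.ofReal_natCast, ENNReal.ofReal_ofNat]
    refine add_le_add (hνle.trans ?_) ((hδle _).trans (by exact_mod_cast hcard))
    gcongr
    norm_num
  refine ⟨ν + δ, htotal, fun a b hab hsub01 => ?_⟩
  have hfin : (ν + δ) (Ioo a b) ≠ ⊤ :=
    ((measure_mono hsub01).trans htotal).trans_lt ENNReal.ofReal_lt_top |>.ne
  have hm : (a + b) / 2 ∈ Ioo a b := ⟨by linarith, by linarith⟩
  set m := (a + b) / 2
  have hba : 0 ≤ b - a := sub_nonneg.2 hab.le
  have hμ0 : 0 ≤ (ν + δ).real (Ioo a b) := measureReal_nonneg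
  by_cases hdis : Disjoint (Ioo a b) (S : Set ℝ)
  · have hsub : Ioo a b ⊆ Ω := fun x hx => ⟨hsub01 hx, Set.disjoint_left.1 hdis hx⟩
    refine ⟨Polynomial.C (D 1 m) * Polynomial.X + Polynomial.C (φ m - D 1 m * m),
      Polynomial.degree_linear_le, fun x hx => ?_⟩
    have h := sq_sub_tangent_le (φ := D 0) (g := D 1) (H := D 2) (L := L)
      (V := (ν + δ).real (Ioo a b)) hab
      (fun x hx => hD 0 (by omega) x (hsub hx)) (fun x hx => hD 1 (by omega) x (hsub hx))
      (hcont.mono hsub) (fun x hx => hD1 x (hsub hx)) hμ0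
      (by
        rw [← hνI, ofReal_measureReal hfin, Measure.add_apply]
        exact le_self_add) hm hx
    rw [hD0] at h
    have he : (Polynomial.C (D 1 m) * Polynomial.X + Polynomial.C (φ m - D 1 m * m)).eval x =
        φ m + D 1 m * (x - m) := by
      simp
      ring
    rw [he]
    refine h.trans ?_
    gcongr
    nlinarith [sq_nonneg L]
  · obtain ⟨s, hs, hsS⟩ := Set.not_disjoint_iff.1 hdis
    have hone : 1 ≤ (ν + δ).real (Ioo a b) := by
      have h1 : (1 : ENNReal) ≤ (ν + δ) (Ioo a b) := by
        have h2 : Measure.dirac s (Ioo a b) ≤ δ (Ioo a b) := by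
          rw [hδ, Measure.finsetSum_apply]
          exact Finset.single_le_sum (f := fun s => Measure.dirac s (Ioo a b))
            (fun _ _ => zero_le) hsS
        rw [Measure.dirac_apply_of_mem hs] at h2
        rw [Measure.add_apply]
        exact h2.trans le_add_self
      simpa [Measure.real] using ENNReal.toReal_mono hfin h1
    refine ⟨Polynomial.C (φ m), Polynomial.degree_C_le.trans zero_le_one, fun x hx => ?_⟩
    rw [Polynomial.eval_C, ← sq_abs]
    have h1 : |φ x - φ m| ≤ L * (b - a) := by
      refine (hlip x (hsub01 hx) m (hsub01 hm)).trans ?_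
      gcongr
      rw [abs_le]
      constructor <;> linarith [hx.1, hx.2, hm.1, hm.2]
    calc |φ x - φ m| ^ 2 ≤ (L * (b - a)) ^ 2 := by gcongr
      _ = (b - a) ^ 2 * (L ^ 2 * 1) := by ring
      _ ≤ _ := by
        gcongr
        linarith

lemma L2norm01_sub_proj_le_of_lipschitz {P : MeshPartition} {k : ℕ} {L : ℝ} (hL : 0 ≤ L)
    {φ φh : ℝ → ℝ} (hφ : ∀ x ∈ Ioo (0 : ℝ) 1, ∀ y ∈ Ioo (0 : ℝ) 1, |φ x - φ y| ≤ L * |x - y|)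
    (hproj : IsL2Proj P k φ φh) : L2norm01 (fun x => φ x - φh x) ≤ L * P.msize := by
  have h := MeshPartition.integral_sq_sub_proj_le (MeshPartition.tame_of_lipschitz hφ) hproj
    (fun j => Polynomial.C (φ ((P.pt j + P.pt (j + 1)) / 2)))
    (fun _ => Polynomial.degree_C_le.trans (by exact_mod_cast Nat.zero_le k))
    (B := fun _ => (L * P.msize) ^ 2) fun j hj x hx => by
      have hlt := P.hmono j hj
      have hm : (P.pt j + P.pt (j + 1)) / 2 ∈ P.cell j := ⟨by linarith, by linarith⟩
      rw [Polynomial.eval_C, ← sq_abs]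
      have h1 := hφ x (P.cell_subset hj hx) _ (P.cell_subset hj hm)
      have h2 : |x - (P.pt j + P.pt (j + 1)) / 2| ≤ P.msize := by
        refine le_trans ?_ (P.length_le_msize hj)
        rw [abs_le]
        constructor <;> linarith [hx.1, hx.2]
      have h3 : |φ x - φ ((P.pt j + P.pt (j + 1)) / 2)| ≤ L * P.msize := h1.trans (by gcongr)
      gcongr
  rw [← Finset.mul_sum, P.sum_length, mul_one] at h
  exact Real.sqrt_le_iff.2 ⟨mul_nonneg hL P.msize_nonneg, h⟩

lemma L2norm01_sub_proj_le_of_piecewiseClass {P : MeshPartition} {k n p : ℕ} (hk : 1 ≤ k)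
    {L c₀ : ℝ} (hL : 0 ≤ L) (hc₀ : 0 ≤ c₀) {φ φh : ℝ → ℝ}
    (hφ : PiecewiseClass (n + 1) p L c₀ φ) (hproj : IsL2Proj P k φ φh) :
    L2norm01 (fun x => φ x - φh x) ≤
      √((2 * L + L ^ 2) * (2 ^ p * (2 ^ n * (2 * (L + c₀) + c₀)) + p)) *
        P.msize ^ (3 / 2 : ℝ) := by
  obtain ⟨μ, hμ, happrox⟩ := exists_measure_controlling_affine_error hL hc₀ hφ
  set M : ℝ := 2 ^ p * (2 ^ n * (2 * (L + c₀) + c₀)) + p with hM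
  have hM0 : 0 ≤ M := by positivity
  have hfin : ∀ j < P.N, μ (P.cell j) ≠ ⊤ := fun j hj =>
    (((measure_mono (P.cell_subset hj)).trans hμ).trans_lt ENNReal.ofReal_lt_top).ne
  have hpoly : ∀ j, ∃ q : Polynomial ℝ, q.degree ≤ 1 ∧ (j < P.N → ∀ x ∈ P.cell j,
      (φ x - q.eval x) ^ 2 ≤
        (P.pt (j + 1) - P.pt j) ^ 2 * ((2 * L + L ^ 2) * μ.real (P.cell j))) := by
    intro j
    by_cases hj : j < P.N
    · obtain ⟨q, hq, hqe⟩ := happrox _ _ (P.hmono j hj) (P.cell_subset hj)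
      exact ⟨q, hq, fun _ => hqe⟩
    · exact ⟨0, by simp, fun h => absurd h hj⟩
  choose q hq hqe using hpoly
  have hsum : ∑ j ∈ Finset.range P.N, μ.real (P.cell j) ≤ M := by
    have h := (P.sum_measure_cell_le μ).trans hμ
    have h2 := ENNReal.toReal_mono ENNReal.ofReal_ne_top h
    rwa [ENNReal.toReal_sum fun j hj => hfin j (Finset.mem_range.1 hj),
      ENNReal.toReal_ofReal hM0] at h2
  have h0 := P.msize_nonneg
  have h := MeshPartition.integral_sq_sub_proj_le (MeshPartition.tame_of_lipschitz hφ.1) hproj q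
    (fun j => (hq j).trans (by exact_mod_cast hk)) fun j hj => hqe j hj
  have hle : ∫ x in Ioo (0 : ℝ) 1, (φ x - φh x) ^ 2 ≤ (2 * L + L ^ 2) * M * P.msize ^ 3 := by
    refine h.trans ?_
    calc _ ≤ ∑ j ∈ Finset.range P.N, P.msize ^ 3 * (2 * L + L ^ 2) * μ.real (P.cell j) := by
          refine Finset.sum_le_sum fun j hj => ?_
          rw [Finset.mem_range] at hj
          have hl := P.length_le_msize hj
          have hl0 : 0 ≤ P.pt (j + 1) - P.pt j := sub_nonneg.2 (P.hmono j hj).le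
          have hm0 : 0 ≤ μ.real (P.cell j) := measureReal_nonneg
          calc _ = (P.pt (j + 1) - P.pt j) ^ 3 * ((2 * L + L ^ 2) * μ.real (P.cell j)) := by ring
            _ ≤ P.msize ^ 3 * ((2 * L + L ^ 2) * μ.real (P.cell j)) := by gcongr
            _ = _ := by ring
      _ = P.msize ^ 3 * (2 * L + L ^ 2) * ∑ j ∈ Finset.range P.N, μ.real (P.cell j) := by
          rw [Finset.mul_sum]
      _ ≤ P.msize ^ 3 * (2 * L + L ^ 2) * M := by gcongr
      _ = _ := by ring
  refine (Real.sqrt_le_sqrt hle).trans (le_of_eq ?_)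
  rw [Real.sqrt_mul (by positivity)]
  congr 1
  rw [Real.sqrt_eq_rpow, ← Real.rpow_natCast, ← Real.rpow_mul h0]
  norm_num

lemma qkl_of_eq_zero {k l : ℕ} (h : k = 0 ∨ l = 0) : qkl k l = 1 := by
  rcases h with rfl | rfl <;> norm_num [qkl]

lemma qkl_of_pos {k l : ℕ} (hk : 1 ≤ k) (hl : 1 ≤ l) : qkl k l = 3 / 2 := by
  have hk' : (1 : ℝ) ≤ k := by exact_mod_cast hk
  have hl' : (1 : ℝ) ≤ l := by exact_mod_cast hl
  have := le_min hk' hl'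
  exact min_eq_right (by linarith)

end

/-- Lemma 3.1 of the paper: `‖φ - Π_h φ‖_{L²(0,1)} ≤ C h^{q_{k,ℓ}}` for
`φ ∈ C^{ℓ+1}_{p,L,c₀}(0,1)`, with `C` depending only on `k, ℓ, p, L, c₀`. -/
theorem stmt10 (k l p : ℕ) (L c0 : ℝ) (hL : 0 ≤ L) (hc0 : 0 ≤ c0) :
    ∃ C, 0 ≤ C ∧ ∀ (P : MeshPartition) (φ φh : ℝ → ℝ),
      PiecewiseClass l p L c0 φ → IsL2Proj P k φ φh →
      L2norm01 (fun x => φ x - φh x) ≤ C * P.msize ^ qkl k l := by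
  by_cases h : k = 0 ∨ l = 0
  · refine ⟨L, hL, fun P φ φh hφ hproj => ?_⟩
    rw [qkl_of_eq_zero h, Real.rpow_one]
    exact L2norm01_sub_proj_le_of_lipschitz hL hφ.1 hproj
  · rw [not_or] at h
    obtain ⟨n, rfl⟩ := Nat.exists_eq_succ_of_ne_zero h.2
    have hk : 1 ≤ k := Nat.one_le_iff_ne_zero.2 h.1
    refine ⟨√((2 * L + L ^ 2) * (2 ^ p * (2 ^ n * (2 * (L + c0) + c0)) + p)), Real.sqrt_nonneg _,
      fun P φ φh hφ hproj => ?_⟩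
    rw [qkl_of_pos hk (Nat.succ_le_succ (Nat.zero_le n))]
    exact L2norm01_sub_proj_le_of_piecewiseClass hk hL hc0 hφ hproj
end

section
/- Fix integers k ≥ 0, ℓ ≥ 0, p ≥ 0, constants L, c_0 ≥ 0, c > 0, T > 0, and set q_{k,ℓ} := min(min(k,ℓ)+1, 3/2). Let v_0 : ℝ → ℝ be 1-periodic and belong to the periodic class C^{ℓ+1}_{p,L,c_0}. Consider the semi-Lagrangian discontinuous Galerkin scheme: given a partition of (0,1) with mesh size h and time step Δt > 0, set v_h^0 := Π_h v_0 and v_h^{n+1} := Π_h( v_h^n(· − cΔt) ) for n ≥ 0, where v_h^n is extended 1-periodically to ℝ. Then there exists a constant C ≥ 0, depending only on k, ℓ, p, L, c_0, c, such that for every partition, every Δt > 0, and every integer n ≥ 1 with nΔt ≤ T, ‖v_h^n − v_0(· − c nΔt)‖_{L²(0,1)} ≤ C T h^{q_{k,ℓ}} / Δt. -/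
/-- The periodic class `C^{ℓ+1}_{p,L,c₀}`: `1`-periodic, Lipschitz with constant at
most `L`, and `(ℓ+1)`-times continuously differentiable with `|φ^{(ℓ+1)}| ≤ c₀` outside
`S + ℤ` for a finite set `S ⊂ [0,1)` with at most `p` points. -/
def PeriodicClass (l p : ℕ) (L c0 : ℝ) (φ : ℝ → ℝ) : Prop :=
  Function.Periodic φ 1 ∧
  (∀ x y, |φ x - φ y| ≤ L * |x - y|) ∧
  ∃ S : Finset ℝ, (↑S : Set ℝ) ⊆ Set.Ico (0:ℝ) 1 ∧ S.card ≤ p ∧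
    ContDiffOn ℝ (l + 1) φ (intTranslates S)ᶜ ∧
    ∀ x ∈ (intTranslates S)ᶜ,
      |iteratedDerivWithin (l + 1) φ (intTranslates S)ᶜ x| ≤ c0

open Set MeasureTheory

/-- The coefficients of a real polynomial of bounded degree are controlled by its supremum on
`[0,1]`. -/
theorem exists_abs_coeff_le (n : ℕ) : ∃ K : ℝ, 0 ≤ K ∧ ∀ (a : ℕ → ℝ) (B : ℝ),
    (∀ s ∈ Icc (0:ℝ) 1, |∑ j ∈ Finset.range (n + 1), a j * s ^ j| ≤ B) →
    ∀ j ∈ Finset.range (n + 1), |a j| ≤ K * B := by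
  classical
  set node : ℕ → ℝ := fun i => i / (n + 1)
  set K : ℝ := ∑ j ∈ Finset.range (n + 1), ∑ i ∈ Finset.range (n + 1),
    |(Lagrange.basis (Finset.range (n + 1)) node i).coeff j|
  refine ⟨K, by positivity, fun a B hB j hj => ?_⟩
  set q : Polynomial ℝ := ∑ j ∈ Finset.range (n + 1), Polynomial.C (a j) * Polynomial.X ^ j
    with hq
  have hn : (0:ℝ) < n + 1 := by positivity
  have hB0 : 0 ≤ B := (abs_nonneg _).trans (hB 0 (by simp))
  have hinj : InjOn node (Finset.range (n + 1)) := by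
    intro x _ y _ hxy
    simp only [node] at hxy
    field_simp at hxy
    exact_mod_cast hxy
  have hdeg : q.degree < (Finset.range (n + 1)).card := by
    rw [Finset.card_range]
    refine lt_of_le_of_lt (Polynomial.degree_sum_le _ _) ?_
    rw [Finset.sup_lt_iff (by exact_mod_cast WithBot.bot_lt_coe (n + 1))]
    intro i hi
    refine lt_of_le_of_lt (Polynomial.degree_C_mul_X_pow_le _ _) ?_
    exact_mod_cast Finset.mem_range.1 hi
  have heval : ∀ s, q.eval s = ∑ j ∈ Finset.range (n + 1), a j * s ^ j := by
    intro s
    simp [hq, Polynomial.eval_finsetSum]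
  have hcoeff : q.coeff j = a j := by
    simp only [hq, Polynomial.finsetSum_coeff, Polynomial.coeff_C_mul_X_pow]
    rw [Finset.sum_ite_eq]
    simp only [hj, if_true]
  have h1 : a j = ∑ i ∈ Finset.range (n + 1),
      q.eval (node i) * (Lagrange.basis (Finset.range (n + 1)) node i).coeff j := by
    rw [← hcoeff]
    conv_lhs => rw [Lagrange.eq_interpolate hinj hdeg]
    simp [Lagrange.interpolate_apply, Polynomial.finsetSum_coeff]
  have h2 : |a j| ≤ ∑ i ∈ Finset.range (n + 1),
      B * |(Lagrange.basis (Finset.range (n + 1)) node i).coeff j| := by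
    rw [h1]
    refine (Finset.abs_sum_le_sum_abs _ _).trans (Finset.sum_le_sum fun i hi => ?_)
    rw [abs_mul]
    refine mul_le_mul_of_nonneg_right ?_ (abs_nonneg _)
    rw [heval]
    refine hB _ ⟨by positivity, ?_⟩
    rw [div_le_one hn]
    have := Finset.mem_range.1 hi
    exact_mod_cast this.le
  rw [← Finset.mul_sum] at h2
  refine h2.trans ?_
  rw [mul_comm]
  refine mul_le_mul_of_nonneg_right ?_ hB0
  exact Finset.single_le_sum (f := fun j => ∑ i ∈ Finset.range (n + 1),
    |(Lagrange.basis (Finset.range (n + 1)) node i).coeff j|)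
    (fun i _ => Finset.sum_nonneg fun _ _ => abs_nonneg _) hj

/-- First-order Taylor estimate for a Lipschitz function with bounded derivative of some order
`l + 1 ≥ 2` on an interval of length `r ≤ 1`; the constant only deteriorates like `1 / r`. -/
theorem exists_affine_error_le (l : ℕ) (hl : 1 ≤ l) : ∃ K : ℝ, 0 ≤ K ∧
    ∀ (L c0 : ℝ) (f : ℝ → ℝ) (U : Set ℝ), 0 ≤ L → 0 ≤ c0 → IsOpen U →
    (∀ x y, |f x - f y| ≤ L * |x - y|) → ContDiffOn ℝ (l + 1) f U →
    (∀ x ∈ U, |iteratedDerivWithin (l + 1) f U x| ≤ c0) →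
    ∀ α r : ℝ, 0 < r → r ≤ 1 → Icc α (α + r) ⊆ U → ∀ t ∈ Icc 0 r,
      |f (α + t) - f α - deriv f α * t| ≤ K * (L + c0) * (t ^ 2 / r) := by
  obtain ⟨K, hK, hcoef⟩ := exists_abs_coeff_le l
  refine ⟨1 + l * K, by positivity, ?_⟩
  intro L c0 f U hL hc0 hU hlip hf hb α r hr hr1 hsub t ht
  have hαI : α ∈ Icc α (α + r) := ⟨le_rfl, by linarith⟩
  have hud : UniqueDiffOn ℝ (Icc α (α + r)) := uniqueDiffOn_Icc (by linarith)
  have hat : ∀ y ∈ Icc α (α + r), ContDiffAt ℝ (l + 1) f y := fun y hy =>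
    hf.contDiffAt (hU.mem_nhds (hsub hy))
  have hbd : ∀ y ∈ Icc α (α + r), ‖iteratedDerivWithin (l + 1) f (Icc α (α + r)) y‖ ≤ c0 := by
    intro y hy
    rw [iteratedDerivWithin_eq_iteratedDeriv hud (by exact_mod_cast hat y hy) hy,
      ← iteratedDerivWithin_of_isOpen hU (hsub hy)]
    exact hb y (hsub hy)
  set D : ℕ → ℝ := fun j => iteratedDerivWithin j f (Icc α (α + r)) α
  set b : ℕ → ℝ := fun j => (j.factorial : ℝ)⁻¹ * r ^ j * D j with hbdef
  have htay : ∀ s ∈ Icc (0:ℝ) 1,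
      |f (α + r * s) - ∑ j ∈ Finset.range (l + 1), b j * s ^ j| ≤ c0 * (r * s) ^ (l + 1) := by
    intro s hs
    have hrs : 0 ≤ r * s := mul_nonneg hr.le hs.1
    have hx : α + r * s ∈ Icc α (α + r) := ⟨by linarith, by nlinarith [hs.2]⟩
    have := taylor_mean_remainder_bound (by linarith) (hf.mono hsub) hx hbd
    rw [taylor_within_apply, Real.norm_eq_abs] at this
    have e : ∑ k ∈ Finset.range (l + 1), (((k.factorial : ℝ))⁻¹ * (α + r * s - α) ^ k) •
        iteratedDerivWithin k f (Icc α (α + r)) α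
        = ∑ j ∈ Finset.range (l + 1), b j * s ^ j := by
      refine Finset.sum_congr rfl fun j _ => ?_
      simp only [hbdef, D, smul_eq_mul, add_sub_cancel_left, mul_pow]
      ring
    rw [e, add_sub_cancel_left] at this
    refine this.trans (div_le_self (by positivity) ?_)
    exact_mod_cast Nat.one_le_iff_ne_zero.2 (Nat.factorial_ne_zero l)
  have hb0 : b 0 = f α := by simp [hbdef, D]
  have hb1 : b 1 = r * deriv f α := by
    have : D 1 = deriv f α := by
      simp only [D, iteratedDerivWithin_one]
      exact DifferentiableAt.derivWithin
        ((hat α hαI).differentiableAt (by positivity)) (hud α hαI)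
    simp [hbdef, this]
  set a : ℕ → ℝ := fun j => if j = 0 then 0 else b j with ha
  have hsum : ∀ s : ℝ, ∑ j ∈ Finset.range (l + 1), a j * s ^ j
      = ∑ j ∈ Finset.range (l + 1), b j * s ^ j - f α := by
    intro s
    rw [Finset.sum_range_succ', Finset.sum_range_succ' (fun j => b j * s ^ j)]
    simp [ha, hb0]
  have hco := hcoef a ((L + c0) * r) (by
    intro s hs
    rw [hsum]
    have h1 := htay s hs
    have h2 := hlip (α + r * s) α
    have hrs : 0 ≤ r * s := mul_nonneg hr.le hs.1
    have hrs1 : r * s ≤ r := by nlinarith [hs.2]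
    rw [add_sub_cancel_left, abs_of_nonneg hrs] at h2
    have h3 : c0 * (r * s) ^ (l + 1) ≤ c0 * r := by
      refine mul_le_mul_of_nonneg_left ?_ hc0
      refine (pow_le_of_le_one hrs (by linarith) (by omega)).trans hrs1
    have h4 : L * (r * s) ≤ L * r := mul_le_mul_of_nonneg_left hrs1 hL
    rw [abs_le] at h1 h2 ⊢
    constructor <;> linarith [h1.1, h1.2, h2.1, h2.2])
  set s : ℝ := t / r with hs
  have hs01 : s ∈ Icc (0:ℝ) 1 := ⟨div_nonneg ht.1 hr.le, (div_le_one hr).2 ht.2⟩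
  have hrs : r * s = t := by rw [hs]; field_simp
  have h1 := htay s hs01
  rw [hrs] at h1
  obtain ⟨m, rfl⟩ : ∃ m, l = m + 1 := ⟨l - 1, by omega⟩
  have hexp : ∑ j ∈ Finset.range (m + 1 + 1), b j * s ^ j
      = ∑ j ∈ Finset.range m, b (j + 2) * s ^ (j + 2) + deriv f α * t + f α := by
    rw [Finset.sum_range_succ', Finset.sum_range_succ']
    simp only [hb0, pow_zero, mul_one, zero_add, hb1, pow_one, ← hrs]
    ring
  have htail : |∑ j ∈ Finset.range m, b (j + 2) * s ^ (j + 2)|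
      ≤ (m + 1 : ℕ) * (K * ((L + c0) * r) * s ^ 2) := by
    refine (Finset.abs_sum_le_sum_abs _ _).trans ?_
    have : ∀ j ∈ Finset.range m, |b (j + 2) * s ^ (j + 2)| ≤ K * ((L + c0) * r) * s ^ 2 := by
      intro j hj
      have h := hco (j + 2) (by simp at hj ⊢; omega)
      simp only [ha, Nat.add_eq_zero_iff, OfNat.ofNat_ne_zero, and_false, if_false] at h
      rw [abs_mul, abs_of_nonneg (pow_nonneg hs01.1 _)]
      refine mul_le_mul h ?_ (pow_nonneg hs01.1 _) (by positivity)
      exact pow_le_pow_of_le_one hs01.1 hs01.2 (by omega)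
    refine (Finset.sum_le_card_nsmul _ _ _ this).trans ?_
    rw [Finset.card_range, nsmul_eq_mul]
    refine mul_le_mul_of_nonneg_right ?_ (by positivity)
    push_cast; linarith
  have e2 : K * ((L + c0) * r) * s ^ 2 = K * (L + c0) * (t ^ 2 / r) := by
    rw [hs]; field_simp
  rw [e2] at htail
  have h3 : c0 * t ^ (m + 1 + 1) ≤ (L + c0) * (t ^ 2 / r) := by
    have i1 : t ^ (m + 1 + 1) ≤ t ^ 2 :=
      pow_le_pow_of_le_one ht.1 (ht.2.trans hr1) (by omega)
    have i2 : t ^ 2 ≤ t ^ 2 / r := by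
      rw [le_div_iff₀ hr]; nlinarith [sq_nonneg t]
    exact mul_le_mul (by linarith) (i1.trans i2) (pow_nonneg ht.1 _) (by linarith)
  have h4 : |f (α + t) - f α - deriv f α * t| ≤ c0 * t ^ (m + 1 + 1) +
      (m + 1 : ℕ) * (K * (L + c0) * (t ^ 2 / r)) := by
    rw [hexp] at h1
    rw [abs_le] at h1 htail ⊢
    constructor <;> linarith [h1.1, h1.2, htail.1, htail.2]
  calc _ ≤ _ := h4
    _ ≤ (L + c0) * (t ^ 2 / r) + (m + 1 : ℕ) * (K * (L + c0) * (t ^ 2 / r)) := by gcongr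
    _ = _ := by ring

theorem isClosed_intTranslates (S : Finset ℝ) : IsClosed (intTranslates S) := by
  have : intTranslates S = ⋃ s ∈ S, (fun x => s + x) '' range ((↑) : ℤ → ℝ) := by
    ext x
    simp only [intTranslates, mem_ofPred_eq, mem_iUnion, mem_image, exists_range_iff,
      exists_prop, eq_comm]
  rw [this]
  refine S.finite_toSet.isClosed_biUnion fun s _ => ?_
  exact (Homeomorph.addLeft s).isClosedMap _ Int.isClosedEmbedding_coe_real.isClosed_range

/-- Affine approximation of a piecewise smooth Lipschitz function to the right of a point: either
there is a nearby singular point, which the error sees through a Cauchy kernel of width `h`, or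
the error is of the size it has for smooth functions. -/
theorem exists_affine_sq_error_le (l : ℕ) (hl : 1 ≤ l) (L c0 : ℝ) (hL : 0 ≤ L) (hc0 : 0 ≤ c0) :
    ∃ A : ℝ, 0 ≤ A ∧ ∀ (f : ℝ → ℝ) (S : Finset ℝ),
    (∀ x y, |f x - f y| ≤ L * |x - y|) →
    ContDiffOn ℝ (l + 1) f (intTranslates S)ᶜ →
    (∀ x ∈ (intTranslates S)ᶜ, |iteratedDerivWithin (l + 1) f (intTranslates S)ᶜ x| ≤ c0) →
    ∀ α h : ℝ, 0 < h → h ≤ 1 → ∃ m : ℝ,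
      (∃ s ∈ intTranslates S, s ∈ Icc α (α + 1) ∧ ∀ t ∈ Icc 0 h,
        (f (α + t) - f α - m * t) ^ 2 ≤ A * h ^ 2 * (h ^ 2 / (h ^ 2 + (α + t - s) ^ 2))) ∨
      ∀ t ∈ Icc 0 h, (f (α + t) - f α - m * t) ^ 2 ≤ A * h ^ 3 := by
  obtain ⟨K, hK, hloc⟩ := exists_affine_error_le l hl
  set M := K * (L + c0)
  have hM : 0 ≤ M := by positivity
  refine ⟨5 * L ^ 2 + 8 * M ^ 2, by positivity, ?_⟩
  intro f S hlip hf hb α h hh hh1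
  have hcl := isClosed_intTranslates S
  have hloc' := hloc L c0 f _ hL hc0 hcl.isOpen_compl hlip hf hb α
  by_cases hne : (intTranslates S ∩ Icc α (α + 1)).Nonempty
  · obtain ⟨s, ⟨hsS, hs⟩, hmin⟩ := (isCompact_Icc.inter_left hcl).exists_isLeast hne
    by_cases hnear : s - α ≤ 2 * h
    · refine ⟨0, Or.inl ⟨s, hsS, hs, fun t ht => ?_⟩⟩
      have h1 := hlip (α + t) α
      rw [add_sub_cancel_left, abs_of_nonneg ht.1] at h1
      have h2 : L * t ≤ L * h := mul_le_mul_of_nonneg_left ht.2 hL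
      have h3 : (f (α + t) - f α - 0 * t) ^ 2 ≤ (L * h) ^ 2 := by
        rw [zero_mul, sub_zero]
        exact sq_le_sq' (by linarith [abs_le.1 h1]) (by linarith [abs_le.1 h1])
      have h4 : (α + t - s) ^ 2 ≤ (2 * h) ^ 2 :=
        sq_le_sq' (by linarith [ht.1]) (by linarith [ht.2, hs.1])
      have h5 : 1 / 5 ≤ h ^ 2 / (h ^ 2 + (α + t - s) ^ 2) := by
        rw [div_le_div_iff₀ (by norm_num) (by positivity)]
        linarith
      calc _ ≤ (L * h) ^ 2 := h3
        _ = 5 * L ^ 2 * h ^ 2 * (1 / 5) := by ring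
        _ ≤ _ := by
          refine mul_le_mul ?_ h5 (by norm_num) (by positivity)
          refine mul_le_mul_of_nonneg_right ?_ (by positivity)
          nlinarith [sq_nonneg M]
    · push Not at hnear
      refine ⟨deriv f α, Or.inl ⟨s, hsS, hs, fun t ht => ?_⟩⟩
      set ρ := s - α with hρ
      have hρ1 : ρ ≤ 1 := by linarith [hs.2]
      have h1 := hloc' (ρ / 2) (by linarith) (by linarith) (by
        intro y hy hyS
        have := hmin ⟨hyS, hy.1, by linarith [hy.2]⟩
        linarith [hy.2]) t ⟨ht.1, by linarith [ht.2]⟩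
      have hρ0 : 0 < ρ := by linarith
      have h2 : M * (t ^ 2 / (ρ / 2)) ≤ 2 * M * h ^ 2 / ρ := by
        have : t ^ 2 ≤ h ^ 2 := pow_le_pow_left₀ ht.1 ht.2 2
        calc M * (t ^ 2 / (ρ / 2)) ≤ M * (h ^ 2 / (ρ / 2)) := by gcongr
          _ = _ := by field_simp
      have h3 : (f (α + t) - f α - deriv f α * t) ^ 2 ≤ (2 * M * h ^ 2 / ρ) ^ 2 :=
        sq_le_sq' (by linarith [abs_le.1 h1]) (by linarith [abs_le.1 h1])
      refine h3.trans ?_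
      have h4 : (α + t - s) ^ 2 ≤ ρ ^ 2 :=
        sq_le_sq' (by linarith [ht.1]) (by linarith [ht.2])
      have h5 : h ^ 2 + (α + t - s) ^ 2 ≤ 2 * ρ ^ 2 := by nlinarith
      calc (2 * M * h ^ 2 / ρ) ^ 2 = 8 * M ^ 2 * h ^ 2 * (h ^ 2 / (2 * ρ ^ 2)) := by
            field_simp; ring
        _ ≤ _ := by
          gcongr
          nlinarith [sq_nonneg L]
  · refine ⟨deriv f α, Or.inr fun t ht => ?_⟩
    have h1 := hloc' 1 one_pos le_rfl (fun y hy hyS => hne ⟨y, hyS, hy⟩) t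
      ⟨ht.1, ht.2.trans hh1⟩
    rw [div_one] at h1
    have h2 : M * t ^ 2 ≤ M * h ^ 2 :=
      mul_le_mul_of_nonneg_left (pow_le_pow_left₀ ht.1 ht.2 2) hM
    have h3 : (f (α + t) - f α - deriv f α * t) ^ 2 ≤ (M * h ^ 2) ^ 2 :=
      sq_le_sq' (by linarith [abs_le.1 h1]) (by linarith [abs_le.1 h1])
    refine h3.trans ?_
    have h4 : h ^ 4 ≤ h ^ 3 := pow_le_pow_of_le_one hh.le hh1 (by norm_num)
    calc (M * h ^ 2) ^ 2 = M ^ 2 * h ^ 4 := by ring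
      _ ≤ M ^ 2 * h ^ 3 := by gcongr
      _ ≤ _ := by
        refine mul_le_mul_of_nonneg_right ?_ (by positivity)
        nlinarith [sq_nonneg L, sq_nonneg M]


theorem MeshPartition.pt_le_pt_s11 (P : MeshPartition) {i j : ℕ} (hij : i ≤ j) (hj : j ≤ P.N) :
    P.pt i ≤ P.pt j := by
  induction j, hij using Nat.le_induction with
  | base => exact le_rfl
  | succ n _ ih => exact (ih (by omega)).trans (P.hmono n (by omega)).le

theorem MeshPartition.pt_nonneg (P : MeshPartition) {j : ℕ} (hj : j ≤ P.N) : 0 ≤ P.pt j :=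
  P.h0 ▸ P.pt_le_pt_s11 (Nat.zero_le j) hj

theorem MeshPartition.pt_le_one (P : MeshPartition) {j : ℕ} (hj : j ≤ P.N) : P.pt j ≤ 1 :=
  P.h1 ▸ P.pt_le_pt_s11 hj le_rfl

theorem MeshPartition.sub_le_msize (P : MeshPartition) {j : ℕ} (hj : j < P.N) :
    P.pt (j + 1) - P.pt j ≤ P.msize :=
  le_csSup ((finite_Iio P.N).image _).bddAbove ⟨j, hj, rfl⟩

theorem MeshPartition.msize_pos (P : MeshPartition) : 0 < P.msize :=
  lt_of_lt_of_le (sub_pos.2 (P.hmono 0 P.hN)) (P.sub_le_msize P.hN)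

theorem MeshPartition.msize_le_one (P : MeshPartition) : P.msize ≤ 1 := by
  refine csSup_le ⟨_, 0, P.hN, rfl⟩ ?_
  rintro _ ⟨j, hj, rfl⟩
  have hj : j < P.N := hj
  have h1 := P.pt_nonneg hj.le
  have h2 := P.pt_le_one (j := j + 1) hj
  simp only
  linarith

theorem MeshPartition.cell_unique (P : MeshPartition) {i j : ℕ} (hi : i < P.N) (hj : j < P.N)
    {x : ℝ} (hxi : x ∈ Ioo (P.pt i) (P.pt (i + 1))) (hxj : x ∈ Ioo (P.pt j) (P.pt (j + 1))) :
    i = j := by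
  rcases lt_trichotomy i j with h | h | h
  · have := P.pt_le_pt_s11 (i := i + 1) h hj.le
    linarith [hxi.2, hxj.1]
  · exact h
  · have := P.pt_le_pt_s11 (i := j + 1) h hi.le
    linarith [hxj.2, hxi.1]

theorem MeshPartition.ae_mem_cell (P : MeshPartition) :
    ∀ᵐ x ∂(volume.restrict (Ioo (0:ℝ) 1)), ∃ j < P.N, x ∈ Ioo (P.pt j) (P.pt (j + 1)) := by
  have hfin : (P.pt '' Iic P.N).Finite := (finite_Iic P.N).image _
  have hae : ∀ᵐ x ∂(volume.restrict (Ioo (0:ℝ) 1)), x ∉ P.pt '' Iic P.N :=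
    ae_restrict_of_ae (measure_eq_zero_iff_ae_notMem.1 (hfin.measure_zero volume))
  filter_upwards [hae, ae_restrict_mem measurableSet_Ioo] with x hx hx01
  have hex : ∃ j, x < P.pt j ∧ j ≤ P.N := ⟨P.N, P.h1.symm ▸ hx01.2, le_rfl⟩
  classical
  obtain ⟨h1, h2⟩ := Nat.find_spec hex
  have h3 : Nat.find hex ≠ 0 := by
    intro h
    rw [h, P.h0] at h1
    linarith [hx01.1]
  obtain ⟨i, hi⟩ := Nat.exists_eq_succ_of_ne_zero h3
  have h4 := Nat.find_min hex (m := i) (by omega)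
  rw [hi] at h1 h2
  refine ⟨i, by omega, lt_of_le_of_ne ?_ ?_, h1⟩
  · by_contra h
    exact h4 ⟨not_le.1 h, by omega⟩
  · rintro rfl
    exact hx ⟨i, show i ≤ P.N by omega, rfl⟩

/-- Polynomials prescribed on the cells glue to an element of `V_h`. -/
theorem MeshPartition.exists_inVh_s11 (P : MeshPartition) (k : ℕ) (q : ℕ → Polynomial ℝ)
    (hq : ∀ j < P.N, (q j).degree ≤ (k : WithBot ℕ)) :
    ∃ ψ : ℝ → ℝ, InVh P k ψ ∧
      ∀ j < P.N, ∀ x ∈ Ioo (P.pt j) (P.pt (j + 1)), ψ x = (q j).eval x := by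
  classical
  set ψ : ℝ → ℝ := fun x =>
    ∑ j ∈ Finset.range P.N, (Ioo (P.pt j) (P.pt (j + 1))).indicator (fun y => (q j).eval y) x
  have h : ∀ j < P.N, ∀ x ∈ Ioo (P.pt j) (P.pt (j + 1)), ψ x = (q j).eval x := by
    intro j hj x hx
    simp only [ψ]
    rw [Finset.sum_eq_single_of_mem j (Finset.mem_range.2 hj), indicator_of_mem hx]
    intro i hi hij
    refine indicator_of_notMem (fun hxi => hij ?_) _
    exact P.cell_unique (Finset.mem_range.1 hi) hj hxi hx
  exact ⟨ψ, fun j hj => ⟨q j, hq j hj, h j hj⟩, h⟩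

theorem InVh.sub {P : MeshPartition} {k : ℕ} {f g : ℝ → ℝ} (hf : InVh P k f) (hg : InVh P k g) :
    InVh P k (fun x => f x - g x) := by
  intro j hj
  obtain ⟨q, hq, hfq⟩ := hf j hj
  obtain ⟨r, hr, hgr⟩ := hg j hj
  refine ⟨q - r, (Polynomial.degree_sub_le _ _).trans (max_le hq hr), fun x hx => ?_⟩
  simp only [hfq x hx, hgr x hx, Polynomial.eval_sub]

theorem InVh.memLp {P : MeshPartition} {k : ℕ} {f : ℝ → ℝ} (hf : InVh P k f) :
    MemLp f 2 (volume.restrict (Ioo (0:ℝ) 1)) := by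
  classical
  choose! q hq hfq using hf
  have hsum : MemLp (fun x => ∑ j ∈ Finset.range P.N,
      (Ioo (P.pt j) (P.pt (j + 1))).indicator (fun y => (q j).eval y) x) 2
      (volume.restrict (Ioo (0:ℝ) 1)) := by
    refine memLp_finsetSum _ fun j _ => MemLp.indicator measurableSet_Ioo ?_
    obtain ⟨C, hC⟩ := isCompact_Icc.exists_bound_of_continuousOn
      (s := Icc (0:ℝ) 1) (f := fun y => (q j).eval y) (q j).continuous.continuousOn
    refine MemLp.of_bound (q j).continuous.aestronglyMeasurable C ?_
    filter_upwards [ae_restrict_mem measurableSet_Ioo] with x hx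
    exact hC x (Ioo_subset_Icc_self hx)
  refine hsum.ae_eq ?_
  filter_upwards [P.ae_mem_cell] with x ⟨j, hj, hx⟩
  rw [Finset.sum_eq_single_of_mem j (Finset.mem_range.2 hj), indicator_of_mem hx, hfq j hj x hx]
  intro i hi hij
  refine indicator_of_notMem (fun hxi => hij ?_) _
  exact P.cell_unique (Finset.mem_range.1 hi) hj hxi hx

theorem L2norm01_eq_toReal_eLpNorm {f : ℝ → ℝ} (hf : MemLp f 2 (volume.restrict (Ioo (0:ℝ) 1))) :
    L2norm01 f = (eLpNorm f 2 (volume.restrict (Ioo (0:ℝ) 1))).toReal := by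
  rw [hf.eLpNorm_eq_integral_rpow_norm (by norm_num) (by norm_num), ENNReal.toReal_ofReal
    (by positivity), L2norm01, Real.sqrt_eq_rpow]
  norm_num

theorem L2norm01_add_le {f g : ℝ → ℝ} (hf : MemLp f 2 (volume.restrict (Ioo (0:ℝ) 1)))
    (hg : MemLp g 2 (volume.restrict (Ioo (0:ℝ) 1))) :
    L2norm01 (fun x => f x + g x) ≤ L2norm01 f + L2norm01 g := by
  have hfg : L2norm01 (fun x => f x + g x) = _ := L2norm01_eq_toReal_eLpNorm (hf.add hg)
  rw [hfg, L2norm01_eq_toReal_eLpNorm hf,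
    L2norm01_eq_toReal_eLpNorm hg, ← ENNReal.toReal_add hf.eLpNorm_ne_top hg.eLpNorm_ne_top]
  exact ENNReal.toReal_mono (ENNReal.add_ne_top.2 ⟨hf.eLpNorm_ne_top, hg.eLpNorm_ne_top⟩)
    (eLpNorm_add_le hf.1 hg.1 (by norm_num))

theorem L2norm01_sub_comm (f g : ℝ → ℝ) :
    L2norm01 (fun x => f x - g x) = L2norm01 (fun x => g x - f x) := by
  simp only [L2norm01, sub_sq_comm]

theorem setIntegral_Ioo_eq_intervalIntegral (f : ℝ → ℝ) :
    ∫ x in Ioo (0:ℝ) 1, f x = ∫ x in (0:ℝ)..1, f x := by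
  rw [intervalIntegral.integral_of_le zero_le_one, integral_Ioc_eq_integral_Ioo]

theorem L2norm01_comp_sub {f : ℝ → ℝ} (hf : Function.Periodic f 1) (τ : ℝ) :
    L2norm01 (fun x => f (x - τ)) = L2norm01 f := by
  have hp : Function.Periodic (fun x => f x ^ 2) 1 := fun x => by simp only [hf x]
  simp only [L2norm01, setIntegral_Ioo_eq_intervalIntegral]
  rw [intervalIntegral.integral_comp_sub_right (fun x => f x ^ 2) τ]
  have := hp.intervalIntegral_add_eq (0 - τ) 0
  rw [show (0 - τ + 1 : ℝ) = 1 - τ by ring, zero_add] at this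
  rw [this]

theorem memLp_comp_sub {f : ℝ → ℝ} (hf : Function.Periodic f 1)
    (hL : MemLp f 2 (volume.restrict (Ioo (0:ℝ) 1))) (τ : ℝ) :
    MemLp (fun x => f (x - τ)) 2 (volume.restrict (Ioo (0:ℝ) 1)) := by
  have key : ∀ g : ℝ → ℝ, Function.Periodic g 1 → Integrable g (volume.restrict (Ioo (0:ℝ) 1)) →
      Integrable (fun x => g (x - τ)) (volume.restrict (Ioo (0:ℝ) 1)) := by
    intro g hg hi
    have h1 : IntervalIntegrable g volume 0 1 :=
      (intervalIntegrable_iff_integrableOn_Ioo_of_le zero_le_one).2 hi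
    have h2 := (hg.intervalIntegrable₀ one_ne_zero h1 (0 - τ) (1 - τ)).comp_sub_right τ
    simp only [sub_add_cancel] at h2
    exact (intervalIntegrable_iff_integrableOn_Ioo_of_le zero_le_one).1 h2
  have hp : Function.Periodic (fun x => f x ^ 2) 1 := fun x => by simp only [hf x]
  have hm := (key f hf (hL.integrable (by norm_num))).1
  exact (memLp_two_iff_integrable_sq hm).2
    (key _ hp ((memLp_two_iff_integrable_sq hL.1).1 hL))

/-- The projection is nonexpansive relative to any element of `V_h`. -/
theorem IsL2Proj.L2norm01_sub_le {P : MeshPartition} {k : ℕ} {g w ψ : ℝ → ℝ}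
    (hw : IsL2Proj P k g w) (hg : MemLp g 2 (volume.restrict (Ioo (0:ℝ) 1))) (hψ : InVh P k ψ) :
    L2norm01 (fun x => w x - ψ x) ≤ L2norm01 (fun x => g x - ψ x) := by
  have h0 := hw.2 _ (hw.1.sub hψ)
  have m1 := hg.sub hw.1.memLp
  have m2 := hw.1.memLp.sub hψ.memLp
  have i1 : Integrable (fun x => (g x - w x) ^ 2) (volume.restrict (Ioo (0:ℝ) 1)) :=
    (memLp_two_iff_integrable_sq m1.1).1 m1
  have i2 : Integrable (fun x => (w x - ψ x) ^ 2) (volume.restrict (Ioo (0:ℝ) 1)) :=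
    (memLp_two_iff_integrable_sq m2.1).1 m2
  have i3 : Integrable (fun x => (g x - w x) * (w x - ψ x)) (volume.restrict (Ioo (0:ℝ) 1)) :=
    m1.integrable_mul m2
  refine Real.sqrt_le_sqrt ?_
  have e : ∀ x, (g x - ψ x) ^ 2
      = (g x - w x) ^ 2 + (2 * ((g x - w x) * (w x - ψ x)) + (w x - ψ x) ^ 2) := fun x => by ring
  simp only [e]
  rw [integral_add i1 (by exact (i3.const_mul 2).add i2), integral_add (i3.const_mul 2) i2,
    integral_const_mul, h0]
  have : 0 ≤ ∫ x in Ioo (0:ℝ) 1, (g x - w x) ^ 2 := integral_nonneg fun x => sq_nonneg _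
  linarith

/-- Quasi-stability of the projection: comparison with a function `u` approximated by `V_h`. -/
theorem IsL2Proj.L2norm01_sub_le_add {P : MeshPartition} {k : ℕ} {g w u ψ : ℝ → ℝ}
    (hw : IsL2Proj P k g w) (hg : MemLp g 2 (volume.restrict (Ioo (0:ℝ) 1)))
    (hu : MemLp u 2 (volume.restrict (Ioo (0:ℝ) 1))) (hψ : InVh P k ψ) :
    L2norm01 (fun x => w x - u x) ≤
      L2norm01 (fun x => g x - u x) + 2 * L2norm01 (fun x => u x - ψ x) := by
  have h1 := hw.L2norm01_sub_le hg hψ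
  have h2 := L2norm01_add_le (hw.1.memLp.sub hψ.memLp) (hψ.memLp.sub hu)
  have h3 := L2norm01_add_le (hg.sub hu) (hu.sub hψ.memLp)
  simp only [Pi.sub_apply, sub_add_sub_cancel] at h2 h3
  have h4 := L2norm01_sub_comm u ψ
  change L2norm01 (fun x => w x - u x) ≤
    L2norm01 (fun x => w x - ψ x) + L2norm01 (fun x => ψ x - u x) at h2
  change L2norm01 (fun x => g x - ψ x) ≤
    L2norm01 (fun x => g x - u x) + L2norm01 (fun x => u x - ψ x) at h3
  linarith

theorem integrable_cauchyKernel {h : ℝ} (hh : 0 < h) (b : ℝ) :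
    Integrable (fun x : ℝ => h ^ 2 / (h ^ 2 + (x - b) ^ 2)) ∧
      ∫ x : ℝ, h ^ 2 / (h ^ 2 + (x - b) ^ 2) = Real.pi * h := by
  have e : (fun x : ℝ => h ^ 2 / (h ^ 2 + (x - b) ^ 2))
      = fun x => (fun y => (1 + (y / h) ^ 2)⁻¹) (x - b) := by
    funext x
    field_simp
  constructor
  · rw [e]
    exact (integrable_inv_one_add_sq.comp_div hh.ne').comp_sub_right b
  · rw [e, integral_sub_right_eq_self (fun y => (1 + (y / h) ^ 2)⁻¹) b,
      Measure.integral_comp_div (fun y => (1 + y ^ 2)⁻¹) h, integral_univ_inv_one_add_sq,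
      abs_of_pos hh, smul_eq_mul, mul_comm]

theorem setIntegral_cauchyKernel_le {h : ℝ} (hh : 0 < h) (b : ℝ) :
    ∫ x in Ioo (0:ℝ) 1, h ^ 2 / (h ^ 2 + (x - b) ^ 2) ≤ Real.pi * h := by
  obtain ⟨h1, h2⟩ := integrable_cauchyKernel hh b
  exact h2 ▸ setIntegral_le_integral h1 (Filter.Eventually.of_forall fun x => by positivity)

theorem L2norm01_le_of_sq_le {P : MeshPartition} {f F : ℝ → ℝ} {B : ℝ} (hB : 0 ≤ B)
    (hF : IntegrableOn F (Ioo (0:ℝ) 1)) (hFB : ∫ x in Ioo (0:ℝ) 1, F x ≤ B ^ 2)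
    (hfF : ∀ j < P.N, ∀ x ∈ Ioo (P.pt j) (P.pt (j + 1)), f x ^ 2 ≤ F x) : L2norm01 f ≤ B := by
  refine Real.sqrt_le_iff.2 ⟨hB, le_trans ?_ hFB⟩
  refine integral_mono_of_nonneg (Filter.Eventually.of_forall fun x => sq_nonneg _) hF ?_
  filter_upwards [P.ae_mem_cell] with x ⟨j, hj, hx⟩
  exact hfF j hj x hx

/-- Piecewise constant approximation of translates of a Lipschitz function. -/
theorem exists_inVh_error_le_of_lipschitz (k : ℕ) {L : ℝ} (hL : 0 ≤ L) {f : ℝ → ℝ}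
    (hlip : ∀ x y, |f x - f y| ≤ L * |x - y|) (P : MeshPartition) (τ : ℝ) :
    ∃ ψ, InVh P k ψ ∧ L2norm01 (fun x => f (x - τ) - ψ x) ≤ L * P.msize := by
  have hh := P.msize_pos
  obtain ⟨ψ, hψ, hψq⟩ := P.exists_inVh_s11 k (fun j => Polynomial.C (f (P.pt j - τ)))
    (fun j _ => Polynomial.degree_C_le.trans (by exact_mod_cast Nat.zero_le k))
  refine ⟨ψ, hψ, L2norm01_le_of_sq_le (P := P) (F := fun _ => (L * P.msize) ^ 2) (by positivity)
    (continuous_const.integrableOn_Icc.mono_set Ioo_subset_Icc_self) (by simp) ?_⟩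
  intro j hj x hx
  have h1 := hlip (x - τ) (P.pt j - τ)
  have h2 : |x - τ - (P.pt j - τ)| ≤ P.msize := by
    rw [sub_sub_sub_cancel_right, abs_of_nonneg (by linarith [hx.1])]
    linarith [P.sub_le_msize hj, hx.2]
  have h3 := h1.trans (mul_le_mul_of_nonneg_left h2 hL)
  rw [hψq j hj x hx, Polynomial.eval_C]
  exact sq_le_sq' (by linarith [abs_le.1 h3]) (by linarith [abs_le.1 h3])

/-- Every integer translate of a point of `S` in a window of length `2` is among three explicit
candidates per point. -/
theorem exists_mem_range_of_mem_intTranslates {S : Finset ℝ} {s u : ℝ}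
    (hs : s ∈ intTranslates S) (hsu : s ∈ Icc u (u + 2)) :
    ∃ z ∈ S ×ˢ Finset.range 3, s = z.1 + (⌈u - z.1⌉ + z.2 : ℤ) := by
  obtain ⟨z, hz, m, rfl⟩ := hs
  have h1 : ⌈u - z⌉ ≤ m := Int.ceil_le.2 (by linarith [hsu.1])
  have h2 : m ≤ ⌈u - z⌉ + 2 := by
    have := Int.le_ceil (u - z)
    have h3 : (m : ℝ) ≤ (⌈u - z⌉ + 2 : ℤ) := by push_cast; linarith [hsu.2]
    exact_mod_cast h3
  refine ⟨(z, (m - ⌈u - z⌉).toNat), ?_, ?_⟩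
  · simp only [Finset.mem_product, Finset.mem_range]
    exact ⟨hz, by omega⟩
  · have : ⌈u - z⌉ + ((m - ⌈u - z⌉).toNat : ℤ) = m := by omega
    simp only [this]

/-- Piecewise affine approximation of translates of a function of the periodic class. -/
theorem PeriodicClass.exists_inVh_error_le {k l : ℕ} (hk : 1 ≤ k) (hl : 1 ≤ l) (p : ℕ)
    {L c0 : ℝ} (hL : 0 ≤ L) (hc0 : 0 ≤ c0) :
    ∃ M : ℝ, 0 ≤ M ∧ ∀ f, PeriodicClass l p L c0 f → ∀ (P : MeshPartition) (τ : ℝ),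
      ∃ ψ, InVh P k ψ ∧
        L2norm01 (fun x => f (x - τ) - ψ x) ≤ M * P.msize ^ (3 / 2 : ℝ) := by
  obtain ⟨A, hA, hloc⟩ := exists_affine_sq_error_le l hl L c0 hL hc0
  refine ⟨√(A * (3 * p * Real.pi + 1)), Real.sqrt_nonneg _, ?_⟩
  rintro f ⟨-, hlip, S, -, hcard, hsm, hbd⟩ P τ
  set h := P.msize with hhdef
  have hh : 0 < h := P.msize_pos
  choose m hm using fun α => hloc f S hlip hsm hbd α h hh P.msize_le_one
  set q : ℕ → Polynomial ℝ := fun j => Polynomial.C (m (P.pt j - τ)) * Polynomial.X +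
    Polynomial.C (f (P.pt j - τ) - m (P.pt j - τ) * P.pt j)
  obtain ⟨ψ, hψ, hψq⟩ := P.exists_inVh_s11 k q fun j _ =>
    Polynomial.degree_linear_le.trans (by exact_mod_cast hk)
  set b : ℝ × ℕ → ℝ := fun z => z.1 + (⌈-τ - z.1⌉ + z.2 : ℤ) + τ with hb
  set F : ℝ → ℝ := fun x => A * h ^ 2 *
    (∑ z ∈ S ×ˢ Finset.range 3, h ^ 2 / (h ^ 2 + (x - b z) ^ 2)) + A * h ^ 3 with hF
  have hi : ∀ z, IntegrableOn (fun x => h ^ 2 / (h ^ 2 + (x - b z) ^ 2)) (Ioo (0:ℝ) 1) :=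
    fun z => (integrable_cauchyKernel hh (b z)).1.integrableOn
  have hsumi : IntegrableOn (fun x => ∑ z ∈ S ×ˢ Finset.range 3,
      h ^ 2 / (h ^ 2 + (x - b z) ^ 2)) (Ioo (0:ℝ) 1) := integrable_finsetSum _ fun z _ => hi z
  have hci : IntegrableOn (fun _ => A * h ^ 3) (Ioo (0:ℝ) 1) :=
    continuous_const.integrableOn_Icc.mono_set Ioo_subset_Icc_self
  refine ⟨ψ, hψ, L2norm01_le_of_sq_le (P := P) (F := F) (by positivity)
    ((hsumi.const_mul _).add hci) ?_ ?_⟩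
  · have h1 : (√(A * (3 * p * Real.pi + 1)) * h ^ (3 / 2 : ℝ)) ^ 2
        = A * (3 * p * Real.pi + 1) * h ^ 3 := by
      rw [mul_pow, Real.sq_sqrt (by positivity), ← Real.rpow_natCast (h ^ (3 / 2 : ℝ)),
        ← Real.rpow_mul hh.le, ← Real.rpow_natCast h 3]
      norm_num
    have h2 : ∑ z ∈ S ×ˢ Finset.range 3, ∫ x in Ioo (0:ℝ) 1, h ^ 2 / (h ^ 2 + (x - b z) ^ 2)
        ≤ 3 * p * (Real.pi * h) := by
      refine (Finset.sum_le_card_nsmul _ _ _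
        fun z _ => setIntegral_cauchyKernel_le hh (b z)).trans ?_
      rw [Finset.card_product, Finset.card_range, nsmul_eq_mul]
      refine mul_le_mul_of_nonneg_right ?_ (by positivity)
      have : (S.card : ℝ) ≤ p := by exact_mod_cast hcard
      push_cast
      linarith
    rw [h1]
    simp only [hF]
    rw [integral_add (hsumi.const_mul _) hci, integral_const_mul,
      integral_finsetSum _ fun z _ => hi z]
    simp only [integral_const, MeasurableSet.univ, measureReal_restrict_apply, univ_inter,
      Real.volume_real_Ioo, sub_zero, zero_le_one, sup_of_le_left, one_smul]
    calc _ ≤ A * h ^ 2 * (3 * p * (Real.pi * h)) + A * h ^ 3 := by gcongr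
      _ = _ := by ring
  · intro j hj x hx
    have ht : x - P.pt j ∈ Icc 0 h :=
      ⟨by linarith [hx.1], by linarith [hx.2, P.sub_le_msize hj]⟩
    have e1 : P.pt j - τ + (x - P.pt j) = x - τ := by ring
    have e2 : f (x - τ) - ψ x
        = f (x - τ) - f (P.pt j - τ) - m (P.pt j - τ) * (x - P.pt j) := by
      rw [hψq j hj x hx]
      simp only [q, Polynomial.eval_add, Polynomial.eval_mul, Polynomial.eval_C,
        Polynomial.eval_X]
      ring
    rw [e2]
    have hsum0 : 0 ≤ ∑ z ∈ S ×ˢ Finset.range 3, h ^ 2 / (h ^ 2 + (x - b z) ^ 2) :=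
      Finset.sum_nonneg fun z _ => by positivity
    rcases hm (P.pt j - τ) with ⟨s, hsS, hs, hle⟩ | hle
    · have h1 := hle _ ht
      rw [e1] at h1
      obtain ⟨z, hz, rfl⟩ := exists_mem_range_of_mem_intTranslates (u := -τ) hsS
        ⟨by linarith [hs.1, P.pt_nonneg hj.le], by linarith [hs.2, P.pt_le_one hj.le]⟩
      have e3 : x - τ - (z.1 + (⌈-τ - z.1⌉ + z.2 : ℤ)) = x - b z := by
        simp only [hb]; ring
      rw [e3] at h1
      have h2 := Finset.single_le_sum (f := fun z => h ^ 2 / (h ^ 2 + (x - b z) ^ 2))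
        (fun z _ => by positivity) hz
      have h3 : 0 ≤ A * h ^ 3 := by positivity
      have h4 := mul_le_mul_of_nonneg_left h2 (show 0 ≤ A * h ^ 2 by positivity)
      simp only [hF]
      linarith
    · have h1 := hle _ ht
      rw [e1] at h1
      have : 0 ≤ A * h ^ 2 * ∑ z ∈ S ×ˢ Finset.range 3, h ^ 2 / (h ^ 2 + (x - b z) ^ 2) := by
        positivity
      simp only [hF]
      linarith

/-- Approximation of translates of the periodic class by `V_h` with the rate `q_{k,ℓ}`. -/
theorem exists_inVh_error_le_rpow_qkl (k l p : ℕ) {L c0 : ℝ} (hL : 0 ≤ L) (hc0 : 0 ≤ c0) :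
    ∃ M : ℝ, 0 ≤ M ∧ ∀ f, PeriodicClass l p L c0 f → ∀ (P : MeshPartition) (τ : ℝ),
      ∃ ψ, InVh P k ψ ∧ L2norm01 (fun x => f (x - τ) - ψ x) ≤ M * P.msize ^ qkl k l := by
  by_cases hkl : 1 ≤ k ∧ 1 ≤ l
  · have hq : qkl k l = 3 / 2 := by
      refine min_eq_right ?_
      have h1 : (1:ℝ) ≤ min (k:ℝ) l :=
        le_min (by exact_mod_cast hkl.1) (by exact_mod_cast hkl.2)
      linarith
    rw [hq]
    exact PeriodicClass.exists_inVh_error_le hkl.1 hkl.2 p hL hc0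
  · have hq : qkl k l = 1 := by
      have h0 : min (k:ℝ) l = 0 := by
        rcases (by omega : k = 0 ∨ l = 0) with rfl | rfl <;> simp
      rw [qkl, h0]
      norm_num
    refine ⟨L, hL, fun f hf P τ => ?_⟩
    rw [hq, Real.rpow_one]
    exact exists_inVh_error_le_of_lipschitz k hL hf.2.1 P τ

/-- Theorem 4.1 of the paper: error estimate for the semi-Lagrangian DG scheme
`v_h⁰ = Π_h v₀`, `v_h^{n+1} = Π_h(v_h^n(· - cΔt))` for the transport equation
`v_t + c v_x = 0` with `1`-periodic data `v₀ ∈ C^{ℓ+1}_{p,L,c₀}`: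
`‖v_h^n - v₀(· - c n Δt)‖_{L²(0,1)} ≤ C T h^{q_{k,ℓ}} / Δt` for `1 ≤ n`, `nΔt ≤ T`,
with `C` depending only on `k, ℓ, p, L, c₀, c`. -/
theorem stmt11 (k l p : ℕ) (L c0 c : ℝ) (hL : 0 ≤ L) (hc0 : 0 ≤ c0) (hc : 0 < c) :
    ∃ C, 0 ≤ C ∧ ∀ T : ℝ, 0 < T →
      ∀ (P : MeshPartition) (dt : ℝ), 0 < dt →
      ∀ (v0 : ℝ → ℝ) (v : ℕ → ℝ → ℝ),
        PeriodicClass l p L c0 v0 →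
        (∀ n, Function.Periodic (v n) 1) →
        IsL2Proj P k v0 (v 0) →
        (∀ n, IsL2Proj P k (fun x => v n (x - c * dt)) (v (n + 1))) →
        ∀ n : ℕ, 1 ≤ n → (n : ℝ) * dt ≤ T →
          L2norm01 (fun x => v n x - v0 (x - c * ((n : ℝ) * dt)))
            ≤ C * T * P.msize ^ qkl k l / dt := by
  obtain ⟨M, hM, happ⟩ := exists_inVh_error_le_rpow_qkl k l p hL hc0
  refine ⟨4 * M, by positivity, ?_⟩
  intro T hT P dt hdt v0 v hv0 hper hinit hstep n hn hnT
  set δ := M * P.msize ^ qkl k l with hδ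
  have hδ0 : 0 ≤ δ := mul_nonneg hM (Real.rpow_nonneg P.msize_pos.le _)
  have hcont : Continuous v0 := by
    refine (LipschitzWith.of_dist_le_mul (K := ⟨L, hL⟩) fun x y => ?_).continuous
    exact hv0.2.1 x y
  have hu : ∀ τ, MemLp (fun x => v0 (x - τ)) 2 (volume.restrict (Ioo (0:ℝ) 1)) := by
    intro τ
    have hc' : Continuous fun x => v0 (x - τ) := hcont.comp (continuous_id.sub continuous_const)
    obtain ⟨C, hC⟩ := isCompact_Icc.exists_bound_of_continuousOn
      (s := Icc (0:ℝ) 1) hc'.continuousOn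
    refine MemLp.of_bound hc'.aestronglyMeasurable C ?_
    filter_upwards [ae_restrict_mem measurableSet_Ioo] with x hx
    exact hC x (Ioo_subset_Icc_self hx)
  have hv : ∀ n, MemLp (v n) 2 (volume.restrict (Ioo (0:ℝ) 1)) := by
    rintro (_ | n)
    · exact hinit.1.memLp
    · exact (hstep n).1.memLp
  have herr : ∀ n : ℕ, L2norm01 (fun x => v n x - v0 (x - c * ((n : ℝ) * dt)))
      ≤ 2 * (n + 1) * δ := by
    intro n
    induction n with
    | zero =>
      obtain ⟨ψ, hψ, hle⟩ := happ v0 hv0 P 0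
      simp only [sub_zero] at hle
      have h1 := hinit.L2norm01_sub_le_add (by simpa using hu 0) (by simpa using hu 0) hψ
      have h0 : L2norm01 (fun x => v0 x - v0 x) = 0 := by simp [L2norm01]
      simp only [Nat.cast_zero, zero_mul, mul_zero, sub_zero]
      linarith
    | succ n ih =>
      obtain ⟨ψ, hψ, hle⟩ := happ v0 hv0 P (c * (((n + 1 : ℕ) : ℝ) * dt))
      have h1 := (hstep n).L2norm01_sub_le_add (memLp_comp_sub (hper n) (hv n) _)
        (hu (c * (((n + 1 : ℕ) : ℝ) * dt))) hψ
      have hpe : Function.Periodic (fun x => v n x - v0 (x - c * ((n : ℝ) * dt))) 1 := by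
        intro x
        simp only [hper n x]
        rw [add_sub_right_comm, hv0.1]
      have h2 := L2norm01_comp_sub hpe (c * dt)
      have h3 : (fun x => v n (x - c * dt) - v0 (x - c * dt - c * ((n : ℝ) * dt)))
          = fun x => v n (x - c * dt) - v0 (x - c * (((n + 1 : ℕ) : ℝ) * dt)) := by
        funext x
        congr 2
        push_cast
        ring
      rw [h3] at h2
      push_cast at h1 h2 hle ⊢
      linarith
  have hn1 : (1:ℝ) ≤ n := by exact_mod_cast hn
  calc _ ≤ 2 * (n + 1) * δ := herr n
    _ ≤ 4 * n * δ := by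
      refine mul_le_mul_of_nonneg_right ?_ hδ0
      linarith
    _ ≤ 4 * (T / dt) * δ := by
      have := (le_div_iff₀ hdt).2 hnT
      gcongr
    _ = _ := by rw [hδ]; ring
end

section
/- Let c > 0, let 0 = x_{1/2} < x_{3/2} < … < x_{N+1/2} = 1 be a partition of (0,1) into cells I_j = (x_{j−1/2}, x_{j+1/2}), and let k ≥ 0. For functions φ, ψ that are polynomial of degree ≤ k on each cell (with periodic identification of the endpoints), define H_j(φ, ψ) := ∫_{I_j} c φ ψ_x dx − c( φ^−_{j+1/2} ψ^−_{j+1/2} − φ^−_{j−1/2} ψ^+_{j−1/2} ) and H(φ, ψ) := Σ_{j=1}^{N} H_j(φ, ψ), where φ^±_{j+1/2} denote one-sided limits and indices are taken modulo N (so φ^−_{1/2} := φ^−_{N+1/2}). Then for all such φ, ψ: H(φ, ψ) + H(ψ, φ) = − Σ_{j=1}^{N} c [φ]_{j+1/2} [ψ]_{j+1/2}, where [φ]_{j+1/2} := φ^+_{j+1/2} − φ^−_{j+1/2} is the jump at the interface (with periodic identification). -/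
open intervalIntegral in
/-- The upwind DG bilinear form `H(φ, ψ) = Σ_j H_j(φ, ψ)` on a partition
`pt 0 < pt 1 < … < pt N` of `(0,1)`, with periodic identification of the traces.
Elements of `V_h` are represented by the tuple of their cell polynomials:
the left trace of `φ` at the interface `pt (j+1)` is `(Pφ j).eval (pt (j+1))`,
and its left trace at `pt j` (for the cell `j`) comes from the cell `j - 1`
(periodically, from the cell `N - 1`, evaluated at `pt N`). -/
noncomputable def dgH (c : ℝ) (pt : ℕ → ℝ) (N : ℕ) (Pφ Pψ : ℕ → Polynomial ℝ) : ℝ :=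
  ∑ j ∈ Finset.range N,
    ((∫ x in (pt j)..(pt (j + 1)),
        c * (Pφ j).eval x * ((Polynomial.derivative (Pψ j)).eval x))
      - c * ((Pφ j).eval (pt (j + 1)) * (Pψ j).eval (pt (j + 1))
          - (if j = 0 then (Pφ (N - 1)).eval (pt N) else (Pφ (j - 1)).eval (pt j))
              * (Pψ j).eval (pt j)))

/-- The jump `[φ]_{j+1/2} = φ⁺_{j+1/2} - φ⁻_{j+1/2}` at the interface `pt (j+1)`,
with periodic identification at the last interface. -/
noncomputable def dgJump (pt : ℕ → ℝ) (N : ℕ) (P : ℕ → Polynomial ℝ) (j : ℕ) : ℝ :=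
  (if j + 1 = N then (P 0).eval (pt 0) else (P (j + 1)).eval (pt (j + 1)))
    - (P j).eval (pt (j + 1))

/-- Integration by parts for polynomials, in symmetrized form. -/
theorem integral_mul_derivative_add_swap (c a b : ℝ) (p q : Polynomial ℝ) :
    (∫ x in a..b, c * p.eval x * (Polynomial.derivative q).eval x)
      + (∫ x in a..b, c * q.eval x * (Polynomial.derivative p).eval x)
      = c * (p.eval b * q.eval b - p.eval a * q.eval a) := by
  have integrable (p q : Polynomial ℝ) : IntervalIntegrable
      (fun x => c * p.eval x * q.eval x) MeasureTheory.volume a b :=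
    Continuous.intervalIntegrable (by fun_prop) a b
  rw [← intervalIntegral.integral_add (integrable _ _) (integrable _ _),
    intervalIntegral.integral_eq_sub_of_hasDerivAt
      (f := fun x => c * (p.eval x * q.eval x)) _ ((integrable _ _).add (integrable _ _))]
  · ring
  · intro x _
    exact (((p.hasDerivAt x).mul (q.hasDerivAt x)).const_mul c).congr_deriv (by ring)

/-- Lemma 5.1 of the paper, first identity:
`H(φ, ψ) + H(ψ, φ) = - Σ_j c [φ]_{j+1/2} [ψ]_{j+1/2}`. -/
theorem stmt14 (c : ℝ) (hc : 0 < c) (N k : ℕ) (hN : 0 < N)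
    (pt : ℕ → ℝ) (h0 : pt 0 = 0) (h1 : pt N = 1)
    (hmono : ∀ j < N, pt j < pt (j + 1))
    (Pφ Pψ : ℕ → Polynomial ℝ)
    (hφ : ∀ j < N, (Pφ j).degree ≤ (k : WithBot ℕ))
    (hψ : ∀ j < N, (Pψ j).degree ≤ (k : WithBot ℕ)) :
    dgH c pt N Pφ Pψ + dgH c pt N Pψ Pφ
      = -∑ j ∈ Finset.range N, c * dgJump pt N Pφ j * dgJump pt N Pψ j := by
  obtain ⟨M, rfl⟩ := Nat.exists_eq_add_one.mpr hN
  unfold dgH dgJump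
  rw [← Finset.sum_add_distrib]
  have cell (j : ℕ) := integral_mul_derivative_add_swap c (pt j) (pt (j + 1)) (Pφ j) (Pψ j)
  set φL : ℕ → ℝ := fun j =>
    if j = 0 then (Pφ (M + 1 - 1)).eval (pt (M + 1)) else (Pφ (j - 1)).eval (pt j)
  set ψL : ℕ → ℝ := fun j =>
    if j = 0 then (Pψ (M + 1 - 1)).eval (pt (M + 1)) else (Pψ (j - 1)).eval (pt j)
  -- the sum of squared traces, reindexed from right endpoints to left endpoints
  have traces : ∑ j ∈ Finset.range (M + 1),
      c * ((Pφ j).eval (pt (j + 1)) * (Pψ j).eval (pt (j + 1)))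
      = ∑ j ∈ Finset.range (M + 1), c * (φL j * ψL j) := by
    rw [Finset.sum_range_succ, Finset.sum_range_succ']
    simp [φL, ψL]
  have jumps : ∑ j ∈ Finset.range (M + 1),
      c * ((if j + 1 = M + 1 then (Pφ 0).eval (pt 0) else (Pφ (j + 1)).eval (pt (j + 1)))
          - (Pφ j).eval (pt (j + 1)))
        * ((if j + 1 = M + 1 then (Pψ 0).eval (pt 0) else (Pψ (j + 1)).eval (pt (j + 1)))
          - (Pψ j).eval (pt (j + 1)))
      = ∑ j ∈ Finset.range (M + 1),
        c * ((Pφ j).eval (pt j) - φL j) * ((Pψ j).eval (pt j) - ψL j) := by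
    rw [Finset.sum_range_succ, Finset.sum_range_succ']
    congr 1
    · refine Finset.sum_congr rfl fun j hj => ?_
      simp [φL, ψL, (Finset.mem_range.mp hj).ne]
    · simp [φL, ψL]
  rw [jumps, eq_neg_iff_add_eq_zero, ← sub_eq_zero.mpr traces.symm, ← Finset.sum_add_distrib,
    ← Finset.sum_sub_distrib]
  refine Finset.sum_congr rfl fun j _ => ?_
  linear_combination cell j
end

section
/- Define f : ℝ → ℝ by f(x) = x + max( x³ sin(1/x), 0 ) for x ≠ 0 and f(0) = 0. Then f is Lipschitz continuous on [−1,1], but the set of points x ∈ (0,1) at which f is not differentiable is infinite; in particular, f fails to be differentiable at x_k = 1/(kπ) for every sufficiently large positive integer k. -/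
/-- The shattering example `f(x) = x + max(x³ sin(1/x), 0)`, with `f(0) = 0`
(note that in Lean `1/0 = 0` and `sin 0 = 0`, so the formula already gives `f 0 = 0`). -/
noncomputable def fShatter (x : ℝ) : ℝ :=
  x + max (x ^ 3 * Real.sin (1 / x)) 0

/-- The positive part of a function is not differentiable at a simple zero of the function. -/
theorem not_differentiableAt_max_zero {h : ℝ → ℝ} {h' x : ℝ} (hd : HasDerivAt h h' x)
    (hx : h x = 0) (hne : h' ≠ 0) : ¬ DifferentiableAt ℝ (fun y => max (h y) 0) x := by
  intro hm
  have hpos : IsLocalMin (fun y => max (h y) 0) x :=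
    Filter.Eventually.of_forall fun y => by simp [hx]
  have hneg : IsLocalMin (fun y => max (h y) 0 - h y) x :=
    Filter.Eventually.of_forall fun y => by simp [hx]
  have hzero := hneg.hasDerivAt_eq_zero (hm.hasDerivAt.fun_sub hd)
  rw [hpos.deriv_eq_zero] at hzero
  exact hne (by linarith)

theorem hasDerivAt_cube_mul_sin_one_div {x : ℝ} (hx : x ≠ 0) :
    HasDerivAt (fun y : ℝ => y ^ 3 * Real.sin (1 / y))
      (3 * x ^ 2 * Real.sin (1 / x) - x * Real.cos (1 / x)) x := by
  have hinv : HasDerivAt (fun y : ℝ => 1 / y) (-(x ^ 2)⁻¹) x := by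
    simpa only [one_div] using hasDerivAt_inv hx
  refine ((hasDerivAt_pow 3 x).fun_mul hinv.sin).congr_deriv ?_
  push_cast
  field_simp
  ring

theorem hasDerivAt_cube_mul_sin_one_div_zero :
    HasDerivAt (fun y : ℝ => y ^ 3 * Real.sin (1 / y)) 0 0 := by
  rw [hasDerivAt_iff_tendsto_slope_zero]
  have hsq : Filter.Tendsto (fun t : ℝ => t ^ 2) (nhdsWithin 0 {0}ᶜ) (nhds 0) := by
    have h := (continuous_pow (M := ℝ) 2).tendsto 0
    rw [zero_pow two_ne_zero] at h
    exact h.mono_left nhdsWithin_le_nhds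
  refine squeeze_zero_norm' ?_ hsq
  filter_upwards [self_mem_nhdsWithin] with t ht
  have ht : t ≠ 0 := ht
  have heq : t⁻¹ • ((0 + t) ^ 3 * Real.sin (1 / (0 + t)) - 0 ^ 3 * Real.sin (1 / 0))
      = t ^ 2 * Real.sin (1 / t) := by
    simp only [zero_add, smul_eq_mul]
    field_simp
    ring
  rw [heq, Real.norm_eq_abs, abs_mul, abs_of_nonneg (sq_nonneg t)]
  exact mul_le_of_le_one_right (sq_nonneg t) (Real.abs_sin_le_one _)

theorem lipschitzOnWith_cube_mul_sin_one_div :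
    LipschitzOnWith 4 (fun y : ℝ => y ^ 3 * Real.sin (1 / y)) (Set.Icc (-1) 1) := by
  have hderiv : ∀ x ∈ Set.Icc (-1 : ℝ) 1,
      ∃ d, HasDerivAt (fun y : ℝ => y ^ 3 * Real.sin (1 / y)) d x ∧ |d| ≤ 4 := by
    intro x hx
    rcases eq_or_ne x 0 with rfl | h0
    · exact ⟨0, hasDerivAt_cube_mul_sin_one_div_zero, by norm_num⟩
    · refine ⟨_, hasDerivAt_cube_mul_sin_one_div h0, ?_⟩
      have hx1 : |x| ≤ 1 := abs_le.mpr hx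
      have hsin := Real.abs_sin_le_one (1 / x)
      have hcos := Real.abs_cos_le_one (1 / x)
      calc _ ≤ |3 * x ^ 2 * Real.sin (1 / x)| + |x * Real.cos (1 / x)| := abs_sub _ _
        _ = 3 * |x| ^ 2 * |Real.sin (1 / x)| + |x| * |Real.cos (1 / x)| := by
          simp [abs_mul]
        _ ≤ 3 * 1 ^ 2 * 1 + 1 * 1 := by gcongr
        _ = 4 := by norm_num
  choose! d hd hbound using hderiv
  refine (convex_Icc (-1 : ℝ) 1).lipschitzOnWith_of_nnnorm_hasDerivWithin_le
    (fun x hx => (hd x hx).hasDerivWithinAt) fun x hx => ?_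
  rw [← NNReal.coe_le_coe]
  simpa using hbound x hx

theorem lipschitzOnWith_fShatter : LipschitzOnWith 5 fShatter (Set.Icc (-1) 1) := by
  refine LipschitzOnWith.of_dist_le_mul fun x hx y hy => ?_
  have hlip := lipschitzOnWith_cube_mul_sin_one_div.dist_le_mul x hx y hy
  have hmax := abs_max_sub_max_le_abs (x ^ 3 * Real.sin (1 / x)) (y ^ 3 * Real.sin (1 / y)) 0
  simp only [Real.dist_eq, NNReal.coe_ofNat, fShatter] at hlip ⊢
  rw [add_sub_add_comm]
  linarith [abs_add_le (x - y)
    (max (x ^ 3 * Real.sin (1 / x)) 0 - max (y ^ 3 * Real.sin (1 / y)) 0)]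

theorem not_differentiableAt_fShatter {k : ℕ} (hk : 1 ≤ k) :
    ¬ DifferentiableAt ℝ fShatter (1 / ((k : ℝ) * Real.pi)) := by
  intro hf
  have hk0 : (k : ℝ) ≠ 0 := by positivity
  have hx : 1 / ((k : ℝ) * Real.pi) ≠ 0 := by positivity
  have hcos : Real.cos (k * Real.pi) ≠ 0 := by simp [Real.cos_nat_mul_pi]
  refine not_differentiableAt_max_zero (hasDerivAt_cube_mul_sin_one_div hx) ?_ ?_ ?_
  · simp only [one_div_one_div, Real.sin_nat_mul_pi, mul_zero]
  · rw [one_div_one_div, Real.sin_nat_mul_pi, mul_zero, zero_sub, neg_ne_zero]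
    exact mul_ne_zero hx hcos
  · simpa only [fShatter, add_sub_cancel_left] using hf.fun_sub differentiableAt_fun_id

/-- The shattering example: `f` is Lipschitz on `[-1,1]`, but the set of points of
`(0,1)` where `f` is not differentiable is infinite; in particular `f` fails to be
differentiable at `1/(kπ)` for every sufficiently large positive integer `k`. -/
theorem stmt18 :
    (∃ K : NNReal, LipschitzOnWith K fShatter (Set.Icc (-1 : ℝ) 1)) ∧
    {x ∈ Set.Ioo (0:ℝ) 1 | ¬ DifferentiableAt ℝ fShatter x}.Infinite ∧
    ∃ k0 : ℕ, ∀ kk : ℕ, k0 ≤ kk →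
      ¬ DifferentiableAt ℝ fShatter (1 / ((kk : ℝ) * Real.pi)) := by
  refine ⟨⟨5, lipschitzOnWith_fShatter⟩, ?_, 1, fun k hk => not_differentiableAt_fShatter hk⟩
  refine Set.infinite_of_injective_forall_mem
    (f := fun n : ℕ => 1 / (((n + 1 : ℕ) : ℝ) * Real.pi)) ?_ fun n => ⟨⟨?_, ?_⟩, ?_⟩
  · intro m n hmn
    simpa [Real.pi_ne_zero] using hmn
  · positivity
  · rw [div_lt_one (by positivity)]
    push_cast
    nlinarith [Real.pi_gt_three, (Nat.cast_nonneg n : (0 : ℝ) ≤ n)]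
  · exact not_differentiableAt_fShatter (Nat.le_add_left 1 n)
end
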